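/- arXiv:0910.1409 — 2 statements merged into one kernel-verified Lean document; each statement's English description precedes it below -/
import Mathlib

section
/- For every tree T there is a constant D = D(T) such that every shortest-path metric supported on a T-minor-free graph admits a stochastic D-embedding into the family of shortest-path metrics supported on trees. In symbols, for any tree T, 𝓔{T} ⇝ Trees. -/
open scoped BigOperators

/-- A path decomposition of `G` with `t` bags. -/
def IsPathDecomp {V : Type*} (G : SimpleGraph V) (t : ℕ) (X : Fin t → Finset V) : Prop :=
  (∀ v : V, ∃ i, v ∈ X i) ∧
  (∀ ⦃u v : V⦄, G.Adj u v → ∃ i, u ∈ X i ∧ v ∈ X i) ∧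
  (∀ (v : V) (i j l : Fin t), i ≤ j → j ≤ l → v ∈ X i → v ∈ X l → v ∈ X j)

/-- The pathwidth of `G` is at most `k`. -/
def pathwidthLE {V : Type*} (G : SimpleGraph V) (k : ℕ) : Prop :=
  ∃ (t : ℕ) (X : Fin t → Finset V), IsPathDecomp G t X ∧ ∀ i, (X i).card ≤ k + 1

/-- The pathwidth of `G`. -/
noncomputable def pathwidth {V : Type*} (G : SimpleGraph V) : ℕ :=
  sInf {k | pathwidthLE G k}
/-- Shortest-path (pseudo)metric of the metric graph `(G, len)`. -/
noncomputable def spDist {V : Type*} (G : SimpleGraph V) (len : Sym2 V → ℝ) (u v : V) : ℝ :=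
  sInf (Set.range fun w : G.Walk u v => (w.edges.map len).sum)
/-- A finite "metric space": a size `n` together with a distance function on `Fin n`. -/
def FinMetric : Type := (n : ℕ) × (Fin n → Fin n → ℝ)

/-- A family of finite graphs (one set of graphs for each vertex count). -/
def GraphFamily : Type := ∀ n : ℕ, Set (SimpleGraph (Fin n))

/-- The shortest-path metrics supported on (connected) metric graphs from the family `F`. -/
def SupportedMetrics (F : GraphFamily) : Set FinMetric :=
  { Y | ∃ G ∈ F Y.1, G.Connected ∧ ∃ len : Sym2 (Fin Y.1) → ℝ,
      (∀ e, 0 ≤ len e) ∧ ∀ u v, Y.2 u v = spDist G len u v }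
/-- `(X, d)` admits a stochastic `D`-embedding into the family `𝒴`: there is a finitely
supported random metric space `Y ∈ 𝒴` and a random map `F` into it which is almost surely
non-contracting, and whose expected expansion is at most `D` on every pair. -/
def StochEmbeds {X : Type*} [Fintype X] (d : X → X → ℝ) (𝒴 : Set FinMetric) (D : ℝ) : Prop :=
  ∃ (N : ℕ) (p : Fin N → ℝ) (Y : Fin N → FinMetric) (F : (ω : Fin N) → X → Fin (Y ω).1),
    (∀ ω, 0 ≤ p ω) ∧ (∑ ω, p ω = 1) ∧
    (∀ ω, p ω ≠ 0 → Y ω ∈ 𝒴) ∧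
    (∀ ω, p ω ≠ 0 → ∀ x y, d x y ≤ (Y ω).2 (F ω x) (F ω y)) ∧
    (∀ x y, (∑ ω, p ω * (Y ω).2 (F ω x) (F ω y)) ≤ D * d x y)
/-- `H` is a minor of `G` (branch-set characterization). -/
def IsMinor {VH VG : Type*} (H : SimpleGraph VH) (G : SimpleGraph VG) : Prop :=
  ∃ A : VH → Set VG,
    (∀ v, (A v).Nonempty) ∧
    (∀ u v, u ≠ v → Disjoint (A u) (A v)) ∧
    (∀ v, (G.induce (A v)).Connected) ∧
    (∀ ⦃u v⦄, H.Adj u v → ∃ a ∈ A u, ∃ b ∈ A v, G.Adj a b)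
/-- All graphs of pathwidth at most `k`. -/
def PathwidthFam (k : ℕ) : GraphFamily := fun _ => {G | pathwidthLE G k}

/-- All trees (connected acyclic graphs). -/
def TreeFam : GraphFamily := fun _ => {G | G.IsTree}

/-- All trees of pathwidth at most `k`. -/
def TreePathwidthFam (k : ℕ) : GraphFamily := fun _ => {G | G.IsTree ∧ pathwidthLE G k}

/-! ### Excluding a tree bounds the pathwidth -/

section TokenTree

variable {V : Type*}

/-- Binary trees whose nodes carry a token (a vertex) and a branch set. -/
inductive TokenTree (V : Type*)
  | nil : TokenTree V
  | node (v : V) (B : Set V) (l r : TokenTree V) : TokenTree V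

namespace TokenTree

/-- The union of the branch sets. -/
def verts : TokenTree V → Set V
  | nil => ∅
  | node _ B l r => B ∪ (l.verts ∪ r.verts)

/-- The set of tokens. -/
def toks [DecidableEq V] : TokenTree V → Finset V
  | nil => ∅
  | node v _ l r => insert v (l.toks ∪ r.toks)

/-- The set `B` is joined by an edge to the root branch set (if there is one). -/
def AdjRoot (G : SimpleGraph V) (B : Set V) : TokenTree V → Prop
  | nil => True
  | node _ B' _ _ => ∃ a ∈ B, ∃ b ∈ B', G.Adj a b

/-- The branch sets are a minor model of the underlying binary tree. -/
def Good (G : SimpleGraph V) : TokenTree V → Prop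
  | nil => True
  | node v B l r => v ∈ B ∧ (G.induce B).Connected ∧ l.AdjRoot G B ∧ r.AdjRoot G B ∧
      Disjoint B l.verts ∧ Disjoint B r.verts ∧ Disjoint l.verts r.verts ∧ l.Good G ∧ r.Good G

/-- The tree has at most `h` levels. -/
def HeightLE : ℕ → TokenTree V → Prop
  | _, nil => True
  | 0, node _ _ _ _ => False
  | h + 1, node _ _ l r => l.HeightLE h ∧ r.HeightLE h

/-- The first `h` levels of the tree are full. -/
def Full : ℕ → TokenTree V → Prop
  | 0, _ => True
  | _ + 1, nil => False
  | h + 1, node _ _ l r => l.Full h ∧ r.Full h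

/-- Enlarge the root branch set. -/
def absorb (C : Set V) : TokenTree V → TokenTree V
  | nil => nil
  | node v B l r => node v (B ∪ C) l r

variable {G : SimpleGraph V}

theorem AdjRoot.mono {B C : Set V} (h : B ⊆ C) {τ : TokenTree V} (hτ : τ.AdjRoot G B) :
    τ.AdjRoot G C := by
  cases τ with
  | nil => trivial
  | node v B' l r =>
    obtain ⟨a, ha, b, hb, hab⟩ := hτ
    exact ⟨a, h ha, b, hb, hab⟩

theorem heightLE_nil {h : ℕ} : (nil : TokenTree V).HeightLE h := by
  cases h <;> trivial

theorem HeightLE.succ {h : ℕ} {τ : TokenTree V} (hτ : τ.HeightLE h) : τ.HeightLE (h + 1) := by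
  induction τ generalizing h with
  | nil => exact heightLE_nil
  | node v B l r ihl ihr =>
    cases h with
    | zero => exact hτ.elim
    | succ h => exact ⟨ihl hτ.1, ihr hτ.2⟩

theorem Full.of_succ {h : ℕ} {τ : TokenTree V} (hτ : τ.Full (h + 1)) : τ.Full h := by
  induction h generalizing τ with
  | zero => trivial
  | succ h ih =>
    cases τ with
    | nil => exact hτ.elim
    | node v B l r => exact ⟨ih hτ.1, ih hτ.2⟩

theorem Good.toks_subset [DecidableEq V] {τ : TokenTree V} (hτ : τ.Good G) :
    (τ.toks : Set V) ⊆ τ.verts := by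
  induction τ with
  | nil => simp [toks]
  | node v B l r ihl ihr =>
    obtain ⟨hv, -, -, -, -, -, -, hl, hr⟩ := hτ
    have := ihl hl
    have := ihr hr
    simp only [toks, verts, Finset.coe_insert, Finset.coe_union]
    rintro x (rfl | hx | hx)
    · exact Or.inl hv
    · exact Or.inr (Or.inl (ihl hl hx))
    · exact Or.inr (Or.inr (ihr hr hx))

theorem HeightLE.card_toks [DecidableEq V] {h : ℕ} {τ : TokenTree V} (hτ : τ.HeightLE h) :
    τ.toks.card + 1 ≤ 2 ^ h := by
  induction τ generalizing h with
  | nil => simpa [toks] using Nat.one_le_two_pow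
  | node v B l r ihl ihr =>
    cases h with
    | zero => exact hτ.elim
    | succ h =>
      have h1 := ihl hτ.1
      have h2 := ihr hτ.2
      have h3 := Finset.card_insert_le v (l.toks ∪ r.toks)
      have h4 := Finset.card_union_le l.toks r.toks
      simp only [toks, pow_succ]
      omega

/-- Removing the root `v` when one of its two subtrees is empty. -/
theorem Good.absorb {v : V} {B : Set V} {σ : TokenTree V} (hB : (G.induce B).Connected)
    (hadj : σ.AdjRoot G B) (hdis : Disjoint B σ.verts) (hσ : σ.Good G) :
    (σ.absorb B).Good G ∧ (σ.absorb B).verts ⊆ B ∪ σ.verts ∧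
      ∀ C : Set V, (node v B nil nil).AdjRoot G C → (σ.absorb B).AdjRoot G C := by
  cases σ with
  | nil => exact ⟨trivial, by simp [TokenTree.absorb, verts], fun _ _ => trivial⟩
  | node v' B' l r =>
    obtain ⟨hv, hc, hl, hr, hBl, hBr, hlr, hgl, hgr⟩ := hσ
    obtain ⟨a, ha, b, hb, hab⟩ := hadj
    simp only [verts, Set.disjoint_union_right] at hdis
    refine ⟨⟨Or.inl hv, SimpleGraph.connected_induce_union hc.preconnected hB.preconnected hb ha
      hab.symm, hl.mono Set.subset_union_left, hr.mono Set.subset_union_left,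
      ?_, ?_, hlr, hgl, hgr⟩, ?_, ?_⟩
    · exact Set.disjoint_union_left.2 ⟨hBl, hdis.2.1⟩
    · exact Set.disjoint_union_left.2 ⟨hBr, hdis.2.2⟩
    · intro x hx
      simp only [TokenTree.absorb, verts, Set.mem_union] at hx ⊢
      tauto
    · rintro C ⟨c, hc, d, hd, hcd⟩
      exact ⟨c, hc, d, Or.inr hd, hcd⟩

theorem absorb_heightLE {h : ℕ} {C : Set V} {σ : TokenTree V} (hσ : σ.HeightLE h) :
    (σ.absorb C).HeightLE h := by
  cases σ with
  | nil => exact heightLE_nil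
  | node v B l r =>
    cases h with
    | zero => exact hσ.elim
    | succ h => exact hσ

theorem absorb_toks [DecidableEq V] {C : Set V} {σ : TokenTree V} :
    (σ.absorb C).toks = σ.toks := by
  cases σ <;> rfl

theorem good_leaf (u : V) : (node u {u} nil nil).Good G :=
  ⟨rfl, ⟨.of_subsingleton⟩, trivial, trivial, by simp [verts], by simp [verts],
    by simp [verts], trivial, trivial⟩

theorem Good.swap {v : V} {B : Set V} {l r : TokenTree V} (h : (node v B l r).Good G) :
    (node v B r l).Good G := by
  obtain ⟨hv, hc, hl, hr, hBl, hBr, hlr, hgl, hgr⟩ := h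
  exact ⟨hv, hc, hr, hl, hBr, hBl, hlr.symm, hgr, hgl⟩

/-- Given a set `U` of touched vertices, a token tree admits a move if a token can be placed on an
untouched vertex, or a token all of whose neighbours have been touched can be removed. -/
def Move [DecidableEq V] (G : SimpleGraph V) (U : Set V) (h : ℕ) (τ : TokenTree V) : Prop :=
  (∃ u ∉ U, ∃ τ' : TokenTree V, τ'.Good G ∧ τ'.HeightLE h ∧
    τ'.verts = insert u τ.verts ∧ τ'.toks = insert u τ.toks ∧
    ∀ C : Set V, τ.AdjRoot G C → τ'.AdjRoot G C) ∨
  (∃ v ∈ τ.toks, (∀ u, G.Adj v u → u ∈ U) ∧ ∃ τ' : TokenTree V, τ'.Good G ∧ τ'.HeightLE h ∧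
    τ'.verts ⊆ τ.verts ∧ τ'.toks = τ.toks.erase v ∧
    ∀ C : Set V, τ.AdjRoot G C → τ'.AdjRoot G C)

variable [DecidableEq V] {U : Set V} {h : ℕ} {v : V} {B : Set V} {l r : TokenTree V}

theorem Move.swap (hm : (node v B l r).Move G U h) : (node v B r l).Move G U h := by
  have h1 : (node v B r l).verts = (node v B l r).verts := by
    simp only [verts, Set.union_comm r.verts]
  have h2 : (node v B r l).toks = (node v B l r).toks := by
    simp only [toks, Finset.union_comm r.toks]
  unfold Move at hm ⊢
  rwa [h1, h2]

theorem Move.left (hg : (node v B l r).Good G) (hU : (node v B l r).verts ⊆ U)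
    (hhr : r.HeightLE h) (hm : l.Move G U h) : (node v B l r).Move G U (h + 1) := by
  obtain ⟨hv, hc, hl, hr, hBl, hBr, hlr, hgl, hgr⟩ := hg
  rcases hm with ⟨u, hu, τ', h1, h2, h3, h4, h5⟩ | ⟨w, hw, hwU, τ', h1, h2, h3, h4, h5⟩
  · left
    refine ⟨u, hu, node v B τ' r, ⟨hv, hc, h5 _ hl, hr, ?_, hBr, ?_, h1, hgr⟩, ⟨h2, hhr⟩,
      ?_, ?_, fun C hC => hC⟩
    · rw [h3, Set.disjoint_insert_right]
      exact ⟨fun hx => hu (hU (Or.inl hx)), hBl⟩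
    · rw [h3, Set.disjoint_insert_left]
      exact ⟨fun hx => hu (hU (Or.inr (Or.inr hx))), hlr⟩
    · simp only [verts, h3, Set.insert_union, Set.union_insert]
    · simp only [toks, h4, Finset.insert_union, Finset.insert_comm v u]
  · right
    have hwl := hgl.toks_subset hw
    have hwv : v ≠ w := by
      rintro rfl
      exact Set.disjoint_left.1 hBl hv hwl
    have hwr : w ∉ r.toks := fun hx => Set.disjoint_left.1 hlr hwl (hgr.toks_subset hx)
    refine ⟨w, by simp [toks, hw], hwU, node v B τ' r, ⟨hv, hc, h5 _ hl, hr,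
      hBl.mono_right h3, hBr, hlr.mono_left h3, h1, hgr⟩, ⟨h2, hhr⟩, ?_, ?_, fun C hC => hC⟩
    · exact Set.union_subset_union_right _ (Set.union_subset_union_left _ h3)
    · simp only [toks, h4]
      rw [Finset.erase_insert_of_ne hwv, Finset.erase_union_distrib,
        Finset.erase_eq_of_notMem hwr]

theorem Move.of_left_nil (hg : (node v B nil r).Good G) (hU : (node v B nil r).verts ⊆ U)
    (hh : h ≠ 0) (hhr : r.HeightLE h) : (node v B nil r).Move G U (h + 1) := by
  obtain ⟨hv, hc, hl, hr, hBl, hBr, hlr, hgl, hgr⟩ := hg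
  have hBU : B ⊆ U := fun x hx => hU (Or.inl hx)
  have hrU : r.verts ⊆ U := fun x hx => hU (Or.inr (Or.inr hx))
  by_cases hu : ∃ u, G.Adj v u ∧ u ∉ U
  · left
    obtain ⟨u, hvu, hu⟩ := hu
    obtain ⟨k, rfl⟩ := Nat.exists_eq_succ_of_ne_zero hh
    refine ⟨u, hu, node v B (node u {u} nil nil) r, ⟨hv, hc, ⟨v, hv, u, rfl, hvu⟩, hr, ?_, hBr,
      ?_, good_leaf u, hgr⟩, ⟨⟨heightLE_nil, heightLE_nil⟩, hhr⟩, ?_, ?_, fun C hC => hC⟩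
    · simpa [verts] using fun hx => hu (hBU hx)
    · simpa [verts] using fun hx => hu (hrU hx)
    · simp [verts, Set.union_insert]
    · simp [toks, Finset.insert_comm v u]
  · right
    push Not at hu
    obtain ⟨h1, h2, h3⟩ := Good.absorb (v := v) hc hr hBr hgr
    have hvr : v ∉ r.toks := fun hx => Set.disjoint_left.1 hBr hv (hgr.toks_subset hx)
    refine ⟨v, by simp [toks], hu, _, h1, (absorb_heightLE hhr).succ, ?_, ?_, h3⟩
    · simpa [verts] using h2
    · simp [absorb_toks, toks, hvr]

theorem Good.full_or_nil_or_move {τ : TokenTree V} (hτ : τ.Good G) (hh : τ.HeightLE h)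
    (hU : τ.verts ⊆ U) : τ.Full h ∨ τ = nil ∨ τ.Move G U h := by
  induction τ generalizing h with
  | nil => exact Or.inr (Or.inl rfl)
  | node v B l r ihl ihr =>
    cases h with
    | zero => exact hh.elim
    | succ h =>
    have hU' : (node v B r l).verts ⊆ U := by
      simpa only [verts, Set.union_comm r.verts] using hU
    have hlU : l.verts ⊆ U := fun x hx => hU (Or.inr (Or.inl hx))
    have hrU : r.verts ⊆ U := fun x hx => hU (Or.inr (Or.inr hx))
    by_cases hfull : l.Full h ∧ r.Full h
    · exact Or.inl hfull
    have hh0 : h ≠ 0 := by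
      rintro rfl
      exact hfull ⟨trivial, trivial⟩
    right; right
    have hgl : l.Good G := hτ.2.2.2.2.2.2.2.1
    have hgr : r.Good G := hτ.2.2.2.2.2.2.2.2
    rcases ihl hgl hh.1 hlU with hl | rfl | hl
    · rcases ihr hgr hh.2 hrU with hr | rfl | hr
      · exact (hfull ⟨hl, hr⟩).elim
      · exact (Move.of_left_nil hτ.swap hU' hh0 hh.1).swap
      · exact (Move.left hτ.swap hU' hh.1 hr).swap
    · exact Move.of_left_nil hτ hU hh0 hh.2
    · exact Move.left hτ hU hh.2 hl

end TokenTree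

end TokenTree

section ExcludedTree

open TokenTree

variable {V W : Type*} {G : SimpleGraph V}

/-- The vertices that carry a token (those of `K`) or are untouched (those outside `U`) have an
interval representation of width `2 ^ h` in which all tokens start at time `0`. -/
def ActiveIntervals [Fintype V] [DecidableEq V] (G : SimpleGraph V) (h : ℕ) (K U : Finset V) :
    Prop :=
  ∃ a b : V → ℕ, (∀ v, v ∈ K ∨ v ∉ U → a v ≤ b v) ∧ (∀ v ∈ K, a v = 0) ∧
    (∀ u v, u ∈ K ∨ u ∉ U → v ∈ K ∨ v ∉ U → G.Adj u v → a u ≤ b v) ∧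
    ∀ i, ({v | (v ∈ K ∨ v ∉ U) ∧ a v ≤ i ∧ i ≤ b v} : Finset V).card ≤ 2 ^ h

theorem exists_intervals_of_tokenTree [Fintype V] [DecidableEq V] {h : ℕ}
    (hno : ∀ τ : TokenTree V, τ.Good G → ¬ τ.Full h) (τ : TokenTree V) (U : Finset V)
    (hτ : τ.Good G) (hh : τ.HeightLE h) (hU : τ.verts ⊆ U)
    (hclosed : ∀ v ∈ U, v ∉ τ.toks → ∀ u, G.Adj v u → u ∈ U) :
    ActiveIntervals G h τ.toks U := by
  induction hN : 2 * Uᶜ.card + τ.toks.card using Nat.strong_induction_on generalizing τ U with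
  | _ N ih =>
  have htU : ∀ v ∈ τ.toks, v ∈ U := fun v hv => hU (hτ.toks_subset hv)
  have hcompl : ∀ u ∉ U, (insert u U)ᶜ.card + 1 = Uᶜ.card := by
    intro u hu
    rw [Finset.compl_insert, Finset.card_erase_add_one (by simpa using hu)]
  -- placing a token does not change the set of active vertices
  have hplace : ∀ u ∉ U, ∀ τ' : TokenTree V, τ'.Good G → τ'.HeightLE h →
      τ'.verts = insert u τ.verts → τ'.toks = insert u τ.toks →
      ActiveIntervals G h τ.toks U := by
    intro u hu τ' hg' hh' hv' ht'
    have hact : ∀ v, (v ∈ τ'.toks ∨ v ∉ insert u U) ↔ (v ∈ τ.toks ∨ v ∉ U) := by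
      intro v
      rw [ht', Finset.mem_insert, Finset.mem_insert]
      by_cases hvu : v = u
      · subst hvu; simp [hu]
      · simp [hvu]
    obtain ⟨a, b, h1, h2, h3, h4⟩ := ih _ (by
        have := hcompl u hu
        have := Finset.card_insert_le u τ.toks
        rw [ht', ← hN]; omega) τ' (insert u U) hg' hh'
      (by rw [hv', Finset.coe_insert]; exact Set.insert_subset_insert hU)
      (by
        intro v hv hvt w hvw
        rw [ht', Finset.mem_insert, not_or] at hvt
        exact Finset.mem_insert_of_mem
          (hclosed v ((Finset.mem_insert.1 hv).resolve_left hvt.1) hvt.2 w hvw)) rfl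
    simp only [hact] at h1 h3 h4
    exact ⟨a, b, h1, fun v hv => h2 v (by rw [ht']; exact Finset.mem_insert_of_mem hv), h3, h4⟩
  rcases hτ.full_or_nil_or_move hh hU with hf | rfl | ⟨u, hu, τ', h1, h2, h3, h4, -⟩ |
    ⟨w, hw, hwU, τ', h1, h2, h3, h4, -⟩
  · exact (hno τ hτ hf).elim
  · by_cases hex : ∃ u, u ∉ U
    · obtain ⟨u, hu⟩ := hex
      have hh0 : h ≠ 0 := by
        rintro rfl
        exact hno _ hτ trivial
      obtain ⟨k, rfl⟩ := Nat.exists_eq_succ_of_ne_zero hh0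
      exact hplace u hu (node u {u} nil nil) (good_leaf u) ⟨heightLE_nil, heightLE_nil⟩
        (by simp [verts]) (by simp [toks])
    · push Not at hex
      exact ⟨fun _ => 0, fun _ => 0, by simp, by simp, by simp, by simp [hex, toks]⟩
  · exact hplace u hu τ' h1 h2 h3 h4
  · obtain ⟨a, b, g1, g2, g3, g4⟩ := ih _ (by
        rw [h4, ← hN]
        have := Finset.card_erase_lt_of_mem hw
        omega) τ' U h1 h2 (h3.trans hU)
      (by
        intro v hv hvt x hvx
        by_cases hvw : v = w
        · subst hvw; exact hwU x hvx
        · exact hclosed v hv (fun hx => hvt (by rw [h4]; exact Finset.mem_erase.2 ⟨hvw, hx⟩)) x hvx)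
      rfl
    have hact : ∀ v, v ≠ w → (v ∈ τ.toks ∨ v ∉ U) → (v ∈ τ'.toks ∨ v ∉ U) := by
      rintro v hvw (hv | hv)
      · exact Or.inl (by rw [h4]; exact Finset.mem_erase.2 ⟨hvw, hv⟩)
      · exact Or.inr hv
    refine ⟨fun v => if v ∈ τ.toks then 0 else a v + 1, fun v => if v = w then 0 else b v + 1,
      ?_, ?_, ?_, ?_⟩
    · intro v hv
      by_cases hvt : v ∈ τ.toks
      · simp [hvt]
      · have hvw : v ≠ w := by rintro rfl; exact hvt hw
        simpa [hvt, hvw] using g1 v (hact v hvw hv)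
    · intro v hv
      simp [hv]
    · intro u v hu hv huv
      by_cases hut : u ∈ τ.toks
      · simp [hut]
      · have huw : u ≠ w := by rintro rfl; exact hut hw
        have hvw : v ≠ w := by
          rintro rfl
          exact (hu.resolve_left hut) (hwU u huv.symm)
        simpa [hut, hvw] using g3 u v (hact u huw hu) (hact v hvw hv) huv
    · rintro (_ | i)
      · refine (Finset.card_le_card (t := τ.toks) ?_).trans (by have := hh.card_toks; omega)
        intro v hv
        by_contra hvt
        simp [hvt] at hv
      · refine (Finset.card_le_card ?_).trans (g4 i)
        intro v hv
        simp only [Finset.mem_filter, Finset.mem_univ, true_and] at hv ⊢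
        obtain ⟨h5, h6, h7⟩ := hv
        by_cases hvw : v = w
        · simp [hvw] at h7
        · rw [if_neg hvw] at h7
          refine ⟨hact v hvw h5, ?_, by omega⟩
          by_cases hvt : v ∈ τ.toks
          · have := g2 v (by rw [h4]; exact Finset.mem_erase.2 ⟨hvw, hvt⟩)
            omega
          · rw [if_neg hvt] at h6
            omega

/-- A full token tree of sufficient height contains every small tree as a minor. -/
theorem isMinor_of_full [Fintype W] [DecidableEq W] {T : SimpleGraph W} (hT : T.IsTree)
    {τ : TokenTree V} (hτ : τ.Good G) (hf : τ.Full (2 * Fintype.card W)) : IsMinor T G := by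
  have key : ∀ k, k + 1 ≤ Fintype.card W → ∃ (X : Finset W) (A : W → Set V)
      (σ : W → TokenTree V), X.card = k + 1 ∧
      (∀ x ∈ X, ∀ y ∈ X, ∃ p : T.Walk x y, ∀ z ∈ p.support, z ∈ X) ∧
      (∀ x ∈ X, (G.induce (A x)).Connected) ∧
      (∀ x ∈ X, ∀ y ∈ X, x ≠ y →
        Disjoint (A x ∪ (σ x).verts) (A y ∪ (σ y).verts)) ∧
      (∀ x ∈ X, Disjoint (A x) (σ x).verts) ∧
      (∀ x ∈ X, (σ x).Good G ∧ (σ x).Full (2 * (Fintype.card W - (k + 1))) ∧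
        (σ x).AdjRoot G (A x)) ∧
      (∀ x ∈ X, ∀ y ∈ X, T.Adj x y → ∃ a ∈ A x, ∃ b ∈ A y, G.Adj a b) := by
    intro k
    induction k with
    | zero =>
      intro hk
      obtain ⟨ρ⟩ := hT.connected.nonempty
      obtain ⟨j, hj⟩ : ∃ j, Fintype.card W = j + 1 := ⟨_, (Nat.succ_pred_eq_of_pos hk).symm⟩
      rw [hj] at hf ⊢
      cases τ with
      | nil => exact hf.elim
      | node v B l r =>
        obtain ⟨hv, hc, hl, hr, hBl, hBr, hlr, hgl, hgr⟩ := hτ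
        refine ⟨{ρ}, fun _ => B, fun _ => l, by simp, ?_, fun _ _ => hc, ?_, fun _ _ => hBl,
          fun _ _ => ⟨hgl, hf.1.of_succ, hl⟩, ?_⟩
        · simp only [Finset.mem_singleton]
          rintro x rfl y rfl
          exact ⟨.nil, by simp⟩
        · simp only [Finset.mem_singleton]
          rintro x rfl y rfl h
          exact (h rfl).elim
        · simp only [Finset.mem_singleton]
          rintro x rfl y rfl h
          exact (T.loopless.irrefl _ h).elim
    | succ k ih =>
      intro hk
      obtain ⟨X, A, σ, hX, hw, hc, hd, hA, hσ, hadj⟩ := ih (by omega)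
      obtain ⟨j, hj⟩ : ∃ j, Fintype.card W = j + (k + 1 + 1) := ⟨_, (Nat.sub_add_cancel hk).symm⟩
      have e1 : 2 * (Fintype.card W - (k + 1)) = 2 * j + 1 + 1 := by omega
      have e2 : 2 * (Fintype.card W - (k + 1 + 1)) = 2 * j := by omega
      rw [e1] at hσ
      rw [e2]
      obtain ⟨x, hx, y, hy, hyx⟩ : ∃ x, x ∉ X ∧ ∃ y ∈ X, T.Adj y x := by
        obtain ⟨y₀, hy₀⟩ : X.Nonempty := Finset.card_pos.1 (by omega)
        obtain ⟨x₀, hx₀⟩ : ∃ x, x ∉ X := by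
          by_contra! hall
          have := Finset.card_eq_iff_eq_univ X |>.2 (Finset.eq_univ_iff_forall.2 hall)
          omega
        obtain ⟨p⟩ := hT.connected.preconnected y₀ x₀
        obtain ⟨d, -, h1, h2⟩ := p.exists_boundary_dart (X : Set W) hy₀ hx₀
        exact ⟨d.snd, h2, d.fst, h1, d.adj⟩
      have hxX : ∀ z ∈ X, z ≠ x := by
        rintro z hz rfl
        exact hx hz
      have huniq : ∀ z ∈ X, T.Adj x z → z = y := by
        intro z hz hxz
        obtain ⟨p, hp⟩ := hw z hz y hy
        have hb := SimpleGraph.isBridge_iff_forall_walk_mem_edges.1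
          (SimpleGraph.isAcyclic_iff_forall_adj_isBridge.1 hT.isAcyclic hyx.symm)
          (SimpleGraph.Walk.cons hxz p)
        rw [SimpleGraph.Walk.edges_cons, List.mem_cons] at hb
        rcases hb with hb | hb
        · rw [Sym2.eq_iff] at hb
          rcases hb with ⟨-, hb⟩ | ⟨hb, -⟩
          · exact hb.symm
          · exact (hxX z hz hb.symm).elim
        · exact (hx (hp _ (p.fst_mem_support_of_mem_edges hb))).elim
      obtain ⟨hg, hf', hr'⟩ := hσ y hy
      have hdy := hA y hy
      obtain ⟨v, B, l, r, hσy⟩ : ∃ v B l r, σ y = node v B l r := by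
        cases h : σ y with
        | nil => rw [h] at hf'; exact hf'.elim
        | node v B l r => exact ⟨v, B, l, r, rfl⟩
      rw [hσy] at hg hf' hr' hdy
      obtain ⟨hv, hcB, hl, hr, hBl, hBr, hlr, hgl, hgr⟩ := hg
      obtain ⟨v', B', l', r', rfl⟩ : ∃ v' B' l' r', l = node v' B' l' r' := by
        cases l with
        | nil => exact hf'.1.elim
        | node v B l r => exact ⟨v, B, l, r, rfl⟩
      obtain ⟨hv', hcB', hl', -, hBl', -, -, hgl', -⟩ := hgl
      have hyx' : y ≠ x := hxX y hy
      let A' : W → Set V := fun z => if z = x then B' else if z = y then A y ∪ B else A z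
      let σ' : W → TokenTree V := fun z => if z = x then l' else if z = y then r else σ z
      have Ax : A' x = B' := if_pos rfl
      have Sx : σ' x = l' := if_pos rfl
      have Ay : A' y = A y ∪ B := (if_neg hyx').trans (if_pos rfl)
      have Sy : σ' y = r := (if_neg hyx').trans (if_pos rfl)
      have Az : ∀ z ∈ X, z ≠ y → A' z = A z := fun z hz h => (if_neg (hxX z hz)).trans (if_neg h)
      have Sz : ∀ z ∈ X, z ≠ y → σ' z = σ z := fun z hz h => (if_neg (hxX z hz)).trans (if_neg h)
      have hsub : ∀ z ∈ X, A' z ∪ (σ' z).verts ⊆ A z ∪ (σ z).verts := by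
        intro z hz
        by_cases hzy : z = y
        · subst hzy
          rw [Ay, Sy, hσy]
          simp only [verts]
          intro w hw
          simp only [Set.mem_union] at hw ⊢
          tauto
        · rw [Az z hz hzy, Sz z hz hzy]
      have hxsub : A' x ∪ (σ' x).verts ⊆ (node v' B' l' r').verts := by
        rw [Ax, Sx]
        simp only [verts]
        intro w hw
        simp only [Set.mem_union] at hw ⊢
        tauto
      have hxsub' : A' x ∪ (σ' x).verts ⊆ A y ∪ (σ y).verts := by
        refine hxsub.trans ?_
        rw [hσy]
        intro w hw
        exact Or.inr (Or.inr (Or.inl hw))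
      have hAyl : Disjoint (A y) (node v' B' l' r').verts := by
        refine hdy.mono_right fun w hw => Or.inr (Or.inl hw)
      have hxd : ∀ z ∈ X, Disjoint (A' x ∪ (σ' x).verts) (A' z ∪ (σ' z).verts) := by
        intro z hz
        by_cases hzy : z = y
        · subst hzy
          refine Disjoint.mono_left hxsub ?_
          rw [Ay, Sy]
          exact (((hAyl.symm.union_right hBl.symm)).union_right hlr)
        · exact ((hd y hy z hz (Ne.symm hzy)).mono hxsub' (hsub z hz))
      refine ⟨insert x X, A', σ', by rw [Finset.card_insert_of_notMem hx, hX], ?_, ?_, ?_, ?_, ?_,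
        ?_⟩
      · have hxw : ∀ z ∈ X, ∃ p : T.Walk x z, ∀ w ∈ p.support, w ∈ insert x X := by
          intro z hz
          obtain ⟨p, hp⟩ := hw y hy z hz
          refine ⟨.cons hyx.symm p, fun w hw => ?_⟩
          rw [SimpleGraph.Walk.support_cons, List.mem_cons] at hw
          rcases hw with rfl | hw
          · exact Finset.mem_insert_self _ _
          · exact Finset.mem_insert_of_mem (hp w hw)
        intro s hs t ht
        rcases Finset.mem_insert.1 hs with rfl | hs'
        · rcases Finset.mem_insert.1 ht with rfl | ht'
          · exact ⟨.nil, by simp⟩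
          · exact hxw t ht'
        · rcases Finset.mem_insert.1 ht with rfl | ht'
          · obtain ⟨p, hp⟩ := hxw s hs'
            exact ⟨p.reverse, fun w hw => hp w (by simpa using hw)⟩
          · obtain ⟨p, hp⟩ := hw s hs' t ht'
            exact ⟨p, fun w hw => Finset.mem_insert_of_mem (hp w hw)⟩
      · intro z hz
        rcases Finset.mem_insert.1 hz with rfl | hz
        · rwa [Ax]
        · by_cases hzy : z = y
          · subst hzy
            obtain ⟨a, ha, b, hb, hab⟩ := hr'
            rw [Ay]
            exact SimpleGraph.connected_induce_union (hc z hz).preconnected hcB.preconnected ha hb hab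
          · rw [Az z hz hzy]; exact hc z hz
      · intro s hs t ht hst
        rcases Finset.mem_insert.1 hs with rfl | hs'
        · rcases Finset.mem_insert.1 ht with rfl | ht'
          · exact (hst rfl).elim
          · exact hxd t ht'
        · rcases Finset.mem_insert.1 ht with rfl | ht'
          · exact (hxd s hs').symm
          · exact (hd s hs' t ht' hst).mono (hsub s hs') (hsub t ht')
      · intro z hz
        rcases Finset.mem_insert.1 hz with rfl | hz
        · rwa [Ax, Sx]
        · by_cases hzy : z = y
          · subst hzy
            rw [Ay, Sy]
            exact Disjoint.union_left (hdy.mono_right fun w hw => Or.inr (Or.inr hw)) hBr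
          · rw [Az z hz hzy, Sz z hz hzy]; exact hA z hz
      · intro z hz
        rcases Finset.mem_insert.1 hz with rfl | hz
        · rw [Ax, Sx]
          exact ⟨hgl', hf'.1.1, hl'⟩
        · by_cases hzy : z = y
          · subst hzy
            rw [Ay, Sy]
            exact ⟨hgr, hf'.2.of_succ, hr.mono Set.subset_union_right⟩
          · rw [Az z hz hzy, Sz z hz hzy]
            exact ⟨(hσ z hz).1, (hσ z hz).2.1.of_succ.of_succ, (hσ z hz).2.2⟩
      · have hAsub : ∀ z ∈ X, A z ⊆ A' z := by
          intro z hz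
          by_cases hzy : z = y
          · subst hzy
            rw [Ay]
            exact Set.subset_union_left
          · rw [Az z hz hzy]
        have hxadj : ∀ z ∈ X, T.Adj x z → ∃ a ∈ A' z, ∃ b ∈ A' x, G.Adj a b := by
          intro z hz hxz
          obtain rfl := huniq z hz hxz
          obtain ⟨a, ha, b, hb, hab⟩ := hl
          exact ⟨a, by rw [Ay]; exact Or.inr ha, b, by rw [Ax]; exact hb, hab⟩
        intro s hs t ht hst
        rcases Finset.mem_insert.1 hs with rfl | hs'
        · rcases Finset.mem_insert.1 ht with rfl | ht'
          · exact (T.loopless.irrefl _ hst).elim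
          · obtain ⟨a, ha, b, hb, hab⟩ := hxadj t ht' hst
            exact ⟨b, hb, a, ha, hab.symm⟩
        · rcases Finset.mem_insert.1 ht with rfl | ht'
          · exact hxadj s hs' hst.symm
          · obtain ⟨a, ha, b, hb, hab⟩ := hadj s hs' t ht' hst
            exact ⟨a, hAsub s hs' ha, b, hAsub t ht' hb, hab⟩
  have hpos : 0 < Fintype.card W := Fintype.card_pos_iff.2 hT.connected.nonempty
  obtain ⟨k, hk⟩ := Nat.exists_eq_succ_of_ne_zero hpos.ne'
  obtain ⟨X, A, σ, hX, -, hc, hd, -, -, hadj⟩ := key k (by omega)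
  have hall : ∀ x, x ∈ X := by
    intro x
    rw [(Finset.card_eq_iff_eq_univ X).1 (by omega)]
    exact Finset.mem_univ x
  refine ⟨A, fun x => ?_, fun x y hxy => ?_, fun x => hc x (hall x),
    fun x y hxy => hadj x (hall x) y (hall y) hxy⟩
  · obtain ⟨⟨a, ha⟩⟩ := (hc x (hall x)).nonempty
    exact ⟨a, ha⟩
  · exact (hd x (hall x) y (hall y) hxy).mono Set.subset_union_left Set.subset_union_left

/-- A graph without a given tree minor has an interval representation (equivalently, a path
decomposition) of bounded width. -/
theorem exists_intervals_of_not_isMinor [Fintype V] [Fintype W] {T : SimpleGraph W}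
    (hT : T.IsTree) (hG : ¬ IsMinor T G) :
    ∃ a b : V → ℕ, (∀ v, a v ≤ b v) ∧ (∀ u v, G.Adj u v → a u ≤ b v) ∧
      ∀ i, {v | a v ≤ i ∧ i ≤ b v}.ncard ≤ 2 ^ (2 * Fintype.card W) := by
  classical
  obtain ⟨a, b, h1, -, h3, h4⟩ := exists_intervals_of_tokenTree (G := G)
    (fun τ hτ hf => hG (isMinor_of_full hT hτ hf)) TokenTree.nil ∅ trivial heightLE_nil
    (by simp [verts]) (by simp)
  refine ⟨a, b, fun v => h1 v (by simp), fun u v => h3 u v (by simp) (by simp), fun i => ?_⟩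
  rw [Set.ncard_eq_toFinset_card']
  convert h4 i using 2
  ext v
  simp

end ExcludedTree

/-! ### Chains with bounded cost and rooted forests -/

section Reach

variable {V : Type*}

/-- `Reach A u v c`: there is a chain of steps from `u` to `v` of total cost at most `c`. -/
inductive Reach (A : V → V → ℝ → Prop) : V → V → ℝ → Prop
  | refl (u : V) {c : ℝ} : 0 ≤ c → Reach A u u c
  | cons {u v w : V} {a b : ℝ} : A u v a → Reach A v w b → Reach A u w (a + b)

namespace Reach

variable {A B : V → V → ℝ → Prop} {u v w : V} {c c' : ℝ}

theorem mono (h : Reach A u v c) (hc : c ≤ c') : Reach A u v c' := by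
  induction h generalizing c' with
  | refl u h0 => exact .refl u (h0.trans hc)
  | @cons u v w a b h _ ih =>
    have := cons h (ih (c' := c' - a) (by linarith))
    rwa [add_sub_cancel] at this

theorem trans (h : Reach A u v c) (h' : Reach A v w c') : Reach A u w (c + c') := by
  induction h with
  | refl u h0 => exact h'.mono (by linarith)
  | cons h _ ih =>
    rw [add_assoc]
    exact cons h (ih h')

theorem single (h : A u v c) : Reach A u v c := by
  simpa using cons h (refl v le_rfl)

theorem symm (hA : ∀ u v a, A u v a → A v u a) (h : Reach A u v c) : Reach A v u c := by
  induction h with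
  | refl u h0 => exact refl u h0
  | cons h _ ih =>
    rw [add_comm]
    exact ih.trans (single (hA _ _ _ h))

theorem imp (hAB : ∀ u v a, A u v a → B u v a) (h : Reach A u v c) : Reach B u v c := by
  induction h with
  | refl u h0 => exact refl u h0
  | cons h _ ih => exact cons (hAB _ _ _ h) ih

theorem nonneg (hA : ∀ u v a, A u v a → 0 ≤ a) (h : Reach A u v c) : 0 ≤ c := by
  induction h with
  | refl u h0 => exact h0
  | cons h _ ih => exact add_nonneg (hA _ _ _ h) ih

end Reach

/-- One step along an edge of a metric graph. -/
def edgeStep (H : SimpleGraph V) (len : Sym2 V → ℝ) (u v : V) (a : ℝ) : Prop :=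
  H.Adj u v ∧ a = len s(u, v)

theorem edgeStep_symm {H : SimpleGraph V} {len : Sym2 V → ℝ} (u v : V) (a : ℝ)
    (h : edgeStep H len u v a) : edgeStep H len v u a :=
  ⟨h.1.symm, by rw [Sym2.eq_swap]; exact h.2⟩

theorem edgeStep_nonneg {H : SimpleGraph V} {len : Sym2 V → ℝ} (hlen : ∀ e, 0 ≤ len e)
    (u v : V) (a : ℝ) (h : edgeStep H len u v a) : 0 ≤ a :=
  h.2 ▸ hlen _

theorem reach_of_walk {H : SimpleGraph V} (len : Sym2 V → ℝ) {u v : V} (p : H.Walk u v) :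
    Reach (edgeStep H len) u v (p.edges.map len).sum := by
  induction p with
  | nil => exact .refl _ (by simp)
  | cons h p ih =>
    rw [SimpleGraph.Walk.edges_cons, List.map_cons, List.sum_cons]
    exact .cons ⟨h, rfl⟩ ih

theorem Reach.exists_walk {H : SimpleGraph V} {len : Sym2 V → ℝ} {u v : V} {c : ℝ}
    (h : Reach (edgeStep H len) u v c) : ∃ p : H.Walk u v, (p.edges.map len).sum ≤ c := by
  induction h with
  | refl u h0 => exact ⟨.nil, by simpa using h0⟩
  | cons h _ ih =>
    obtain ⟨p, hp⟩ := ih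
    obtain ⟨hadj, rfl⟩ := h
    exact ⟨.cons hadj p, by simpa using hp⟩

theorem Reach.reachable {H : SimpleGraph V} {len : Sym2 V → ℝ} {u v : V} {c : ℝ}
    (h : Reach (edgeStep H len) u v c) : H.Reachable u v :=
  let ⟨p, _⟩ := h.exists_walk
  ⟨p⟩

/-- Shortest paths exist in finite metric graphs. -/
theorem exists_shortest_path [Finite V] {H : SimpleGraph V} {len : Sym2 V → ℝ}
    (hlen : ∀ e, 0 ≤ len e) {u v : V} (h : H.Reachable u v) :
    ∃ p : H.Walk u v, p.IsPath ∧
      ∀ c, Reach (edgeStep H len) u v c → (p.edges.map len).sum ≤ c := by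
  classical
  have := Fintype.ofFinite V
  obtain ⟨q⟩ := h
  have : Nonempty (H.Path u v) := ⟨q.toPath⟩
  obtain ⟨p, hp⟩ := Finite.exists_min fun p : H.Path u v => ((p : H.Walk u v).edges.map len).sum
  refine ⟨p, p.2, fun c hc => ?_⟩
  obtain ⟨r, hr⟩ := hc.exists_walk
  refine (hp r.toPath).trans (le_trans ?_ hr)
  have hsub : List.Sublist (r.toPath : H.Walk u v).edges r.edges :=
    SimpleGraph.Walk.edges_bypass_sublist_edges r
  exact (hsub.map len).sum_le_sum (by simpa using fun e _ => hlen e)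

/-- A rooted forest on a subset of `V`, given by weighted parent pointers. -/
structure Forest (V : Type*) where
  /-- The parent of a vertex, if any. -/
  par : V → Option V
  /-- The length of the edge to the parent. -/
  wt : V → ℝ
  /-- A height function witnessing acyclicity. -/
  rk : V → ℕ

namespace Forest

/-- One step along an edge of a forest. -/
def step (F : Forest V) (u v : V) (a : ℝ) : Prop :=
  (F.par u = some v ∧ a = F.wt u) ∨ (F.par v = some u ∧ a = F.wt v)

theorem step_symm {F : Forest V} (u v : V) (a : ℝ) (h : F.step u v a) : F.step v u a :=
  Or.symm h

/-- `F` is acyclic and its edges are at least as long as the distances in `(H, len)`. -/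
def Valid (F : Forest V) (H : SimpleGraph V) (len : Sym2 V → ℝ) : Prop :=
  ∀ v u, F.par v = some u → F.rk u < F.rk v ∧ Reach (edgeStep H len) v u (F.wt v)

/-- Potentials can be prescribed along the edges of a forest. -/
theorem exists_potential [Finite V] (F : Forest V) (hF : ∀ v u, F.par v = some u → F.rk u < F.rk v)
    (f : V → V → ℕ) : ∃ φ : V → ℕ, ∀ v u, F.par v = some u → φ v = φ u + f v u := by
  have key : ∀ n, ∃ φ : V → ℕ, ∀ v u, F.rk v < n → F.par v = some u → φ v = φ u + f v u := by
    intro n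
    induction n with
    | zero => exact ⟨fun _ => 0, fun v u h => by omega⟩
    | succ n ih =>
      obtain ⟨φ, hφ⟩ := ih
      refine ⟨fun v => if F.rk v < n then φ v else
        match F.par v with
        | none => 0
        | some u => φ u + f v u, fun v u hv hu => ?_⟩
      have := hF v u hu
      by_cases hvn : F.rk v < n
      · have hun : F.rk u < n := by omega
        simpa [hvn, hun] using hφ v u hvn hu
      · have hun : F.rk u < n := by omega
        simp [hvn, hun, hu]
  obtain ⟨n, hn⟩ := (Set.finite_range F.rk).bddAbove
  obtain ⟨φ, hφ⟩ := key (n + 1)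
  exact ⟨φ, fun v u h => hφ v u (Nat.lt_succ_of_le (hn ⟨v, rfl⟩)) h⟩

end Forest

end Reach

section Geodesic

variable {V : Type*} {H : SimpleGraph V} {len : Sym2 V → ℝ}

/-- A geodesic carries a forest which is isometric to the ambient metric graph. -/
theorem exists_geodesic_forest (hlen : ∀ e, 0 ≤ len e) {x y : V} (q : H.Walk x y)
    (hq : q.IsPath)
    (hmin : ∀ c, Reach (edgeStep H len) x y c → (q.edges.map len).sum ≤ c) :
    ∃ F : Forest V, F.Valid H len ∧
      (∀ v u, F.par v = some u → v ∈ q.support ∧ u ∈ q.support) ∧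
      (∀ u ∈ q.support, ∀ v ∈ q.support, ∀ c, Reach (edgeStep H len) u v c →
        Reach F.step u v c) ∧
      ∀ v ∈ q.support, ∃ s e, Reach F.step x v s ∧ Reach (edgeStep H len) v y e ∧
        s + e ≤ (q.edges.map len).sum := by
  classical
  induction q with
  | nil =>
    refine ⟨⟨fun _ => none, fun _ => 0, fun _ => 0⟩, by simp [Forest.Valid], by simp, ?_, ?_⟩
    · intro u hu v hv c hc
      simp only [SimpleGraph.Walk.support_nil, List.mem_singleton] at hu hv
      subst hu hv
      exact .refl _ (hc.nonneg (edgeStep_nonneg hlen))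
    · intro v hv
      simp only [SimpleGraph.Walk.support_nil, List.mem_singleton] at hv
      subst hv
      exact ⟨0, 0, .refl _ le_rfl, .refl _ le_rfl, by simp⟩
  | @cons x x' y hadj q' ih =>
    rw [SimpleGraph.Walk.cons_isPath_iff] at hq
    obtain ⟨hq', hx⟩ := hq
    simp only [SimpleGraph.Walk.edges_cons, List.map_cons, List.sum_cons] at hmin ⊢
    have hstep : edgeStep H len x x' (len s(x, x')) := ⟨hadj, rfl⟩
    obtain ⟨F, hF, hsupp, hiso, hinv⟩ := ih hq' fun c hc => by
      have := hmin _ (.cons hstep hc)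
      linarith
    let F' : Forest V := ⟨Function.update F.par x (some x'),
      Function.update F.wt x (len s(x, x')), Function.update F.rk x (F.rk x' + 1)⟩
    have hx'q : x' ∈ q'.support := q'.start_mem_support
    have hxx' : x' ≠ x := fun h => hx (h ▸ hx'q)
    have hFF' : ∀ u v a, F.step u v a → F'.step u v a := by
      have aux : ∀ u v, F.par u = some v → u ≠ x := fun u v h hu => hx (hu ▸ (hsupp u v h).1)
      rintro u v a (⟨h, rfl⟩ | ⟨h, rfl⟩)
      · exact .inl (by simp [F', aux _ _ h, h])
      · exact .inr (by simp [F', aux _ _ h, h])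
    have hstep' : F'.step x x' (len s(x, x')) := .inl (by simp [F'])
    have hinv' : ∀ v ∈ (SimpleGraph.Walk.cons hadj q').support, ∃ s e, Reach F'.step x v s ∧
        Reach (edgeStep H len) v y e ∧ s + e ≤ len s(x, x') + (q'.edges.map len).sum := by
      intro v hv
      rw [SimpleGraph.Walk.support_cons, List.mem_cons] at hv
      obtain rfl | hv := hv
      · exact ⟨0, _, .refl _ le_rfl, .cons hstep (reach_of_walk len q'), by simp⟩
      · obtain ⟨s, e, hs, he, hse⟩ := hinv v hv
        exact ⟨_, e, .cons hstep' (hs.imp hFF'), he, by linarith⟩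
    have hfrom : ∀ v ∈ (SimpleGraph.Walk.cons hadj q').support, ∀ c,
        Reach (edgeStep H len) x v c → Reach F'.step x v c := by
      intro v hv c hc
      obtain ⟨s, e, hs, he, hse⟩ := hinv' v hv
      have := hmin _ (hc.trans he)
      exact hs.mono (by linarith)
    refine ⟨F', ?_, ?_, ?_, hinv'⟩
    · intro v u hvu
      by_cases hv : v = x
      · subst hv
        obtain rfl : x' = u := by simpa [F'] using hvu
        exact ⟨by simp [F', hxx'], by simpa [F'] using Reach.single hstep⟩
      · have hvu' : F.par v = some u := by simpa [F', hv] using hvu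
        have hu : u ≠ x := fun h => hx (h ▸ (hsupp v u hvu').2)
        simpa [F', hv, hu] using hF v u hvu'
    · intro v u hvu
      simp only [SimpleGraph.Walk.support_cons, List.mem_cons]
      by_cases hv : v = x
      · obtain rfl : x' = u := by simpa [F', hv] using hvu
        exact ⟨.inl hv, .inr hx'q⟩
      · have := hsupp v u (by simpa [F', hv] using hvu)
        exact ⟨.inr this.1, .inr this.2⟩
    · intro u hu v hv c hc
      by_cases hux : u = x
      · subst hux
        exact hfrom v hv c hc
      by_cases hvx : v = x
      · subst hvx
        exact (hfrom u hu c (hc.symm edgeStep_symm)).symm Forest.step_symm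
      simp only [SimpleGraph.Walk.support_cons, List.mem_cons, hux, hvx, false_or] at hu hv
      exact (hiso u hu v hv c hc).imp hFF'

end Geodesic

section Spine

variable {V : Type*} {H : SimpleGraph V} {len : Sym2 V → ℝ} {a b : V → ℕ}

/-- A walk in an interval overlap graph visits every time between its ends. -/
theorem exists_mem_support_interval (hab : ∀ u v, H.Adj u v → a u ≤ b v) {x y : V}
    (q : H.Walk x y) {i : ℕ} (hx : a x ≤ i) (hy : i ≤ b y) :
    ∃ p ∈ q.support, a p ≤ i ∧ i ≤ b p := by
  induction q with
  | nil => exact ⟨_, by simp, hx, hy⟩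
  | @cons x x' y h q ih =>
    by_cases hi : i ≤ b x
    · exact ⟨x, by simp, hx, hi⟩
    · obtain ⟨p, hp, hpi⟩ := ih (by have := hab _ _ h.symm; omega) hy
      exact ⟨p, by simp [hp], hpi⟩

theorem exists_spine_of_component [Finite V] (hlen : ∀ e, 0 ≤ len e)
    (hab : ∀ u v, H.Adj u v → a u ≤ b v) (C : H.ConnectedComponent) :
    ∃ (F : Forest V) (P : Set V), F.Valid H len ∧
      (∀ v u, F.par v = some u → v ∈ P ∧ u ∈ P) ∧
      (∀ u ∈ P, ∀ v ∈ P, ∀ c, Reach (edgeStep H len) u v c → Reach F.step u v c) ∧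
      P ⊆ C.supp ∧ P.Nonempty ∧
      ∀ v ∈ C.supp, ∀ i, a v ≤ i → i ≤ b v → ∃ p ∈ P, a p ≤ i ∧ i ≤ b p := by
  obtain ⟨x, hxC, hx⟩ := C.supp.toFinite.exists_minimalFor a _ C.nonempty_supp
  obtain ⟨y, hyC, hy⟩ := C.supp.toFinite.exists_maximalFor b _ C.nonempty_supp
  obtain ⟨q, hq, hmin⟩ := exists_shortest_path hlen
    (SimpleGraph.ConnectedComponent.exact (Eq.trans hxC (Eq.symm hyC)) : H.Reachable x y)
  obtain ⟨F, hF, hsupp, hiso, -⟩ := exists_geodesic_forest hlen q hq hmin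
  refine ⟨F, {v | v ∈ q.support}, hF, hsupp, hiso, fun v hv => ?_, ⟨x, q.start_mem_support⟩,
    fun v hv i h1 h2 => ?_⟩
  · have : H.Reachable x v := by
      classical exact ⟨q.takeUntil v hv⟩
    exact (SimpleGraph.ConnectedComponent.sound this.symm).trans hxC
  · refine exists_mem_support_interval hab q (le_trans ?_ h1) (h2.trans ?_)
    · exact (le_total (a x) (a v)).elim id fun h => hx hv h
    · exact (le_total (b v) (b y)).elim id fun h => hy hv h

/-- Every component contains a geodesic that meets all times met by the component. -/
theorem exists_spine [Finite V] (hlen : ∀ e, 0 ≤ len e)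
    (hab : ∀ u v, H.Adj u v → a u ≤ b v) :
    ∃ (F : Forest V) (P : Set V), F.Valid H len ∧
      (∀ v u, F.par v = some u → v ∈ P ∧ u ∈ P) ∧
      (∀ u ∈ P, ∀ v ∈ P, ∀ c, Reach (edgeStep H len) u v c → Reach F.step u v c) ∧
      (∀ v, ∃ p ∈ P, H.Reachable v p) ∧
      ∀ v i, a v ≤ i → i ≤ b v → ∃ p ∈ P, H.Reachable v p ∧ a p ≤ i ∧ i ≤ b p := by
  choose F P hF hsupp hiso hPC hne hhit using fun C : H.ConnectedComponent =>
    exists_spine_of_component hlen hab C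
  let c := H.connectedComponentMk
  have hc : ∀ {u v}, H.Reachable u v → c u = c v := SimpleGraph.ConnectedComponent.sound
  have hcP : ∀ {C v}, v ∈ P C → c v = C := fun {C v} h => hPC C h
  let F' : Forest V := ⟨fun v => (F (c v)).par v, fun v => (F (c v)).wt v,
    fun v => (F (c v)).rk v⟩
  have hcomp : ∀ {C u v x}, (F C).step u v x → c u = C ∧ c v = C := by
    rintro C u v x (⟨h, -⟩ | ⟨h, -⟩)
    · exact ⟨hcP (hsupp _ _ _ h).1, hcP (hsupp _ _ _ h).2⟩
    · exact ⟨hcP (hsupp _ _ _ h).2, hcP (hsupp _ _ _ h).1⟩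
  have hstep : ∀ C u v x, (F C).step u v x → F'.step u v x := by
    intro C u v x h
    obtain ⟨h1, h2⟩ := hcomp h
    simpa [F', Forest.step, h1, h2] using h
  refine ⟨F', {v | v ∈ P (c v)}, ?_, ?_, ?_, ?_, ?_⟩
  · intro v u h
    have h' := hF _ v u h
    have := hc h'.2.reachable
    simpa [F', this] using h'
  · intro v u h
    obtain ⟨h1, h2⟩ := hsupp _ v u h
    exact ⟨h1, by simpa [hcP h2] using h2⟩
  · intro u hu v hv x h
    have := hc h.reachable
    exact (hiso (c u) u hu v (by simpa [this] using hv) x h).imp (hstep _)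
  · intro v
    obtain ⟨p, hp⟩ := hne (c v)
    exact ⟨p, by simpa [hcP hp] using hp, SimpleGraph.ConnectedComponent.exact (hcP hp).symm⟩
  · intro v i h1 h2
    obtain ⟨p, hp, h⟩ := hhit (c v) v rfl i h1 h2
    exact ⟨p, by simpa [hcP hp] using hp, SimpleGraph.ConnectedComponent.exact (hcP hp).symm, h⟩

/-- Nearest point projections to a set that meets every component. -/
theorem exists_projection [Finite V] (hlen : ∀ e, 0 ≤ len e) {P : Set V}
    (hP : ∀ v, ∃ p ∈ P, H.Reachable v p) :
    ∃ (h : V → ℝ) (π : V → V), ∀ v, 0 ≤ h v ∧ π v ∈ P ∧ Reach (edgeStep H len) v (π v) (h v) ∧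
      ∀ p ∈ P, ∀ c, Reach (edgeStep H len) v p c → h v ≤ c := by
  have key : ∀ v, ∃ (h : ℝ) (p : V), 0 ≤ h ∧ p ∈ P ∧ Reach (edgeStep H len) v p h ∧
      ∀ p ∈ P, ∀ c, Reach (edgeStep H len) v p c → h ≤ c := by
    intro v
    obtain ⟨p₀, hp₀⟩ := hP v
    have : Nonempty {p // p ∈ P ∧ H.Reachable v p} := ⟨⟨p₀, hp₀⟩⟩
    choose q _ hqm using fun p : {p // p ∈ P ∧ H.Reachable v p} =>
      exists_shortest_path hlen p.2.2
    obtain ⟨p, hp⟩ := Finite.exists_min fun p => ((q p).edges.map len).sum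
    have hr := reach_of_walk len (q p)
    exact ⟨_, p, hr.nonneg (edgeStep_nonneg hlen), p.2.1, hr, fun p' hp' c hc =>
      (hp ⟨p', hp', hc.reachable⟩).trans (hqm ⟨p', hp', hc.reachable⟩ c hc)⟩
  choose h π hh using key
  exact ⟨h, π, hh⟩

end Spine

section Graft

variable {V : Type*} {H : SimpleGraph V} {len : Sym2 V → ℝ}

/-- The forest `S` is isometric on `P`, and `π` is a nearest point projection to `P` with
distance function `h`. -/
structure IsSpine (H : SimpleGraph V) (len : Sym2 V → ℝ) (S : Forest V) (P : Set V)
    (h : V → ℝ) (π : V → V) : Prop where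
  valid : S.Valid H len
  mem : ∀ v u, S.par v = some u → u ∈ P
  iso : ∀ u ∈ P, ∀ v ∈ P, ∀ c, Reach (edgeStep H len) u v c → Reach S.step u v c
  par_mem : ∀ v u, S.par v = some u → v ∈ P
  nonneg : ∀ v, 0 ≤ h v
  proj_mem : ∀ v, π v ∈ P
  proj : ∀ v, Reach (edgeStep H len) v (π v) (h v)
  le : ∀ v, ∀ p ∈ P, ∀ c, Reach (edgeStep H len) v p c → h v ≤ c

/-- Delete all edges that meet `P`. -/
def SimpleGraph.avoid (H : SimpleGraph V) (P : Set V) : SimpleGraph V where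
  Adj u v := H.Adj u v ∧ u ∉ P ∧ v ∉ P
  symm := ⟨fun _ _ h => ⟨h.1.symm, h.2.2, h.2.1⟩⟩
  loopless := ⟨fun _ h => h.1.ne rfl⟩

theorem edgeStep_of_avoid {P : Set V} (u v : V) (c : ℝ) (h : edgeStep (H.avoid P) len u v c) :
    edgeStep H len u v c :=
  ⟨h.1.1, h.2⟩

theorem Reach.notMem_of_avoid {P : Set V} {u v : V} {c : ℝ}
    (h : Reach (edgeStep (H.avoid P) len) u v c) (huv : u ≠ v) : u ∉ P := by
  cases h with
  | refl _ _ => exact absurd rfl huv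
  | cons h _ => exact h.1.2.1

theorem Forest.Valid.notMem {F : Forest V} {P : Set V} (hF : F.Valid (H.avoid P) len) {u v : V}
    (h : F.par v = some u) : v ∉ P ∧ u ∉ P := by
  obtain ⟨h1, h2⟩ := hF v u h
  have huv : u ≠ v := by rintro rfl; exact lt_irrefl _ h1
  exact ⟨h2.notMem_of_avoid huv.symm, (h2.symm edgeStep_symm).notMem_of_avoid huv⟩

/-- The edge above `v` survives a cut of the potential `φ` at the multiples of `M`, shifted by
`α`. -/
def Forest.Keeps (F : Forest V) (h : V → ℝ) (φ : V → ℕ) (M α : ℕ) (v : V) : Prop :=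
  ∃ u, F.par v = some u ∧ 0 < h u ∧ (φ u + α) / M = (φ v + α) / M

open Classical in
/-- Cut `F` at the multiples of `M` and attach the pieces to the spine. -/
noncomputable def Forest.graft (F S : Forest V) (P : Set V) (h : V → ℝ) (π : V → V) (φ : V → ℕ)
    (M α R : ℕ) : Forest V where
  par v := if v ∈ P then S.par v else if F.Keeps h φ M α v then F.par v else some (π v)
  wt v := if v ∈ P then S.wt v else if F.Keeps h φ M α v then F.wt v else h v
  rk v := if v ∈ P then S.rk v else F.rk v + R

namespace IsSpine

variable {F S : Forest V} {P : Set V} {h : V → ℝ} {π : V → V} {φ : V → ℕ} {M α R : ℕ}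

theorem graft_valid (hS : IsSpine H len S P h π) (hF : F.Valid (H.avoid P) len)
    (hR : ∀ v, S.rk v < R) : (F.graft S P h π φ M α R).Valid H len := by
  intro v u hvu
  by_cases hv : v ∈ P
  · have hvu' : S.par v = some u := by simpa [Forest.graft, hv] using hvu
    simpa [Forest.graft, hv, hS.mem v u hvu'] using hS.valid v u hvu'
  by_cases hk : F.Keeps h φ M α v
  · have hvu' : F.par v = some u := by simpa [Forest.graft, hv, hk] using hvu
    have := hF v u hvu'
    simpa [Forest.graft, hv, hk, (hF.notMem hvu').2] using
      And.intro this.1 (this.2.imp edgeStep_of_avoid)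
  · obtain rfl : π v = u := by simpa [Forest.graft, hv, hk] using hvu
    have := hR (π v)
    simp only [Forest.graft, hv, hk, hS.proj_mem, if_true, if_false]
    exact ⟨by omega, hS.proj v⟩

theorem graft_step_of_keeps (hF : F.Valid (H.avoid P) len) {u v : V}
    (hvu : F.par v = some u) (hk : F.Keeps h φ M α v) :
    (F.graft S P h π φ M α R).step v u (F.wt v) := by
  have hv := (hF.notMem hvu).1
  exact .inl (by simp [Forest.graft, hv, hk, hvu])

theorem graft_reach_of_mem (hS : IsSpine H len S P h π) {u v : V} {c : ℝ} (hu : u ∈ P)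
    (hv : v ∈ P) (hc : Reach (edgeStep H len) u v c) :
    Reach (F.graft S P h π φ M α R).step u v c := by
  refine (hS.iso u hu v hv c hc).imp ?_
  rintro x y a (⟨hxy, rfl⟩ | ⟨hxy, rfl⟩)
  · exact .inl (by simp [Forest.graft, hS.par_mem _ _ hxy, hxy])
  · exact .inr (by simp [Forest.graft, hS.par_mem _ _ hxy, hxy])

/-- The piece of `v` is attached to the spine at a top vertex `t` close to `v`. -/
theorem exists_top (hS : IsSpine H len S P h π) (hF : F.Valid (H.avoid P) len)
    (hlen : ∀ e, 0 ≤ len e) (hM : 0 < M)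
    (hφ : ∀ v u, F.par v = some u → φ v = φ u + ⌈4 * M * F.wt v / h u⌉₊) (v : V) :
    ∃ t r, 0 ≤ r ∧ φ t ≤ φ v ∧ Reach (F.graft S P h π φ M α R).step v t r ∧
      Reach (edgeStep H len) v t r ∧ 3 * M * r ≤ ((φ v : ℝ) - φ t) * h t ∧
      (φ t + α) / M = (φ v + α) / M ∧
      Reach (F.graft S P h π φ M α R).step t (π t) (h t) := by
  induction hn : F.rk v using Nat.strong_induction_on generalizing v with
  | _ n ih =>
  by_cases hv : v ∈ P
  · exact ⟨v, 0, le_rfl, le_rfl, .refl _ le_rfl, .refl _ le_rfl, by simp, rfl,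
      hS.graft_reach_of_mem hv (hS.proj_mem v) (hS.proj v)⟩
  by_cases hk : F.Keeps h φ M α v
  swap
  · exact ⟨v, 0, le_rfl, le_rfl, .refl _ le_rfl, .refl _ le_rfl, by simp, rfl,
      .single (.inl (by simp [Forest.graft, hv, hk]))⟩
  obtain ⟨u, hvu, hu, hcell⟩ := id hk
  obtain ⟨hrk, hw⟩ := hF v u hvu
  have hw0 := hw.nonneg (edgeStep_nonneg hlen)
  obtain ⟨t, r, hr0, htu, hG, hH, hr, htc, htop⟩ := ih _ (hn ▸ hrk) u rfl
  have hφv := hφ v u hvu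
  have hinc : 4 * M * F.wt v / h u ≤ (φ v : ℝ) - φ u := by
    rw [hφv]
    push_cast
    linarith [Nat.le_ceil (4 * M * F.wt v / h u)]
  rw [div_le_iff₀ hu] at hinc
  have hM' : (0 : ℝ) < M := by exact_mod_cast hM
  have hlt : (φ u : ℝ) - φ t ≤ M := by
    have h1 := Nat.div_add_mod (φ u + α) M
    have h2 := Nat.div_add_mod (φ t + α) M
    have h3 := Nat.mod_lt (φ u + α) hM
    rw [htc] at h2
    have : φ u ≤ φ t + M := by omega
    have : (φ u : ℝ) ≤ φ t + M := by exact_mod_cast this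
    linarith
  have hut : h u ≤ r + h t := hS.le u _ (hS.proj_mem t) _ (hH.trans (hS.proj t))
  have ht0 := hS.nonneg t
  have hr3 : 3 * r ≤ h t := by
    have : M * (3 * r) ≤ M * h t := by nlinarith
    exact le_of_mul_le_mul_left this hM'
  have hd : (0 : ℝ) ≤ (φ v : ℝ) - φ u := by
    rw [hφv]
    push_cast
    linarith [Nat.cast_nonneg (α := ℝ) ⌈4 * M * F.wt v / h u⌉₊]
  refine ⟨t, F.wt v + r, by linarith, by omega, .cons (graft_step_of_keeps hF hvu hk) hG,
    (hw.imp edgeStep_of_avoid).trans hH, ?_, htc.trans hcell, htop⟩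
  have h4 : ((φ v : ℝ) - φ u) * (3 * h u) ≤ ((φ v : ℝ) - φ u) * (4 * h t) :=
    mul_le_mul_of_nonneg_left (by linarith) hd
  linarith

theorem exists_near (hS : IsSpine H len S P h π) (hF : F.Valid (H.avoid P) len)
    (hlen : ∀ e, 0 ≤ len e) (hM : 0 < M)
    (hφ : ∀ v u, F.par v = some u → φ v = φ u + ⌈4 * M * F.wt v / h u⌉₊) (v : V) :
    ∃ p ∈ P, Reach (F.graft S P h π φ M α R).step v p (2 * h v) ∧
      Reach (edgeStep H len) v p (2 * h v) := by
  obtain ⟨t, r, hr0, htu, hG, hH, hr, htc, htop⟩ := hS.exists_top (α := α) (R := R) hF hlen hM hφ v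
  have hM' : (0 : ℝ) < M := by exact_mod_cast hM
  have hlt : (φ v : ℝ) - φ t ≤ M := by
    have h1 := Nat.div_add_mod (φ v + α) M
    have h2 := Nat.div_add_mod (φ t + α) M
    have h3 := Nat.mod_lt (φ v + α) hM
    rw [htc] at h2
    have : φ v ≤ φ t + M := by omega
    have : (φ v : ℝ) ≤ φ t + M := by exact_mod_cast this
    linarith
  have ht0 := hS.nonneg t
  have hr3 : 3 * r ≤ h t := by
    have : M * (3 * r) ≤ M * h t := by nlinarith
    exact le_of_mul_le_mul_left this hM'
  have htv : h t ≤ r + h v :=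
    hS.le t _ (hS.proj_mem v) _ ((hH.symm edgeStep_symm).trans (hS.proj v))
  exact ⟨π t, hS.proj_mem t, (hG.trans htop).mono (by linarith),
    (hH.trans (hS.proj t)).mono (by linarith)⟩

theorem graft_reach (hS : IsSpine H len S P h π) (hF : F.Valid (H.avoid P) len)
    (hlen : ∀ e, 0 ≤ len e) (hM : 0 < M)
    (hφ : ∀ v u, F.par v = some u → φ v = φ u + ⌈4 * M * F.wt v / h u⌉₊) {u v : V} {c : ℝ}
    (hc : Reach (edgeStep H len) v u c) :
    Reach (F.graft S P h π φ M α R).step v u (8 * h u + 5 * c) := by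
  obtain ⟨p, hp, hup, hup'⟩ := hS.exists_near (α := α) (R := R) hF hlen hM hφ u
  obtain ⟨q, hq, hvq, hvq'⟩ := hS.exists_near (α := α) (R := R) hF hlen hM hφ v
  have hqp := ((hvq'.symm edgeStep_symm).trans hc).trans hup'
  have hvu : h v ≤ c + h u := hS.le v _ (hS.proj_mem u) _ (hc.trans (hS.proj u))
  exact ((hvq.trans (hS.graft_reach_of_mem hq hp hqp)).trans
    (hup.symm Forest.step_symm)).mono (by linarith)

end IsSpine

theorem card_filter_shift_le {M : ℕ} (x d : ℕ) :
    (Finset.univ.filter fun α : Fin M => (x + α) / M ≠ (x + d + α) / M).card ≤ d := by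
  induction d with
  | zero => simp
  | succ d ih =>
    have h1 : (Finset.univ.filter fun α : Fin M =>
        (x + d + α) / M ≠ (x + (d + 1) + α) / M).card ≤ 1 := by
      refine Finset.card_le_one.2 fun α hα β hβ => ?_
      simp only [Finset.mem_filter, Finset.mem_univ, true_and] at hα hβ
      have key : ∀ γ : Fin M, (x + d + γ) / M ≠ (x + (d + 1) + γ) / M →
          M ∣ x + d + γ + 1 := by
        intro γ hγ
        by_contra hdvd
        rw [show x + (d + 1) + (γ : ℕ) = x + d + γ + 1 by ring, Nat.succ_div,
          if_neg hdvd, add_zero] at hγ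
        exact hγ rfl
      have h2 := key α hα
      have h3 := key β hβ
      have : ((x + d + 1) + α : ℕ) ≡ (x + d + 1) + β [MOD M] := by
        rw [Nat.ModEq, show x + d + 1 + (α : ℕ) = x + d + α + 1 by ring,
          show x + d + 1 + (β : ℕ) = x + d + β + 1 by ring,
          Nat.mod_eq_zero_of_dvd h2, Nat.mod_eq_zero_of_dvd h3]
      have := Nat.ModEq.add_left_cancel' _ this
      rw [Nat.ModEq, Nat.mod_eq_of_lt α.2, Nat.mod_eq_of_lt β.2] at this
      exact Fin.ext this
    refine (Finset.card_le_card ?_).trans ((Finset.card_union_le _ _).trans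
      (Nat.add_le_add ih h1))
    intro α
    simp only [Finset.mem_union, Finset.mem_filter, Finset.mem_univ, true_and]
    intro hα
    by_contra! hne
    exact hα (hne.1.trans hne.2)

/-- Cutting at a random shift and attaching the pieces to the spine multiplies the expected
lengths at most by a constant. -/
theorem IsSpine.exists_grafts [Finite V] {F S : Forest V} {P : Set V} {h : V → ℝ} {π : V → V}
    (hS : IsSpine H len S P h π) (hF : F.Valid (H.avoid P) len) (hlen : ∀ e, 0 ≤ len e) {M : ℕ}
    (hM : 0 < M)
    (hMw : ∀ v u, F.par v = some u → 0 < h u → 0 < F.wt v → h u ≤ 4 * M * F.wt v) :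
    ∃ G : Fin M → Forest V, (∀ α, (G α).Valid H len) ∧
      (∀ v, ∀ p ∈ P, ∀ c, Reach (edgeStep H len) v p c → ∀ α, Reach (G α).step v p (5 * c)) ∧
      ∀ u v c, Reach F.step u v c → ∃ c' : Fin M → ℝ, (∀ α, Reach (G α).step u v (c' α)) ∧
        ∑ α, c' α ≤ 70 * M * c := by
  classical
  obtain ⟨φ, hφ⟩ := F.exists_potential (fun v u h => (hF v u h).1)
    fun v u => ⌈4 * M * F.wt v / h u⌉₊
  obtain ⟨R, hR⟩ := (Set.finite_range S.rk).bddAbove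
  have hR' : ∀ v, S.rk v < R + 1 := fun v => Nat.lt_succ_of_le (hR ⟨v, rfl⟩)
  have hM' : (0 : ℝ) < M := by exact_mod_cast hM
  let G : Fin M → Forest V := fun α => F.graft S P h π φ M α (R + 1)
  have hedge : ∀ v u, F.par v = some u → ∃ c' : Fin M → ℝ,
      (∀ α, Reach (G α).step v u (c' α)) ∧ ∑ α, c' α ≤ 70 * M * F.wt v := by
    intro v u hvu
    have hw := (hF v u hvu).2.imp edgeStep_of_avoid
    have hw0 := hw.nonneg (edgeStep_nonneg hlen)
    have hcut : ∀ α, Reach (G α).step v u (8 * h u + 5 * F.wt v) := fun α =>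
      hS.graft_reach hF hlen hM hφ hw
    obtain hu | hu := (hS.nonneg u).eq_or_lt
    · refine ⟨_, hcut, ?_⟩
      rw [← hu]
      simp only [Finset.sum_const, Finset.card_univ, Fintype.card_fin, nsmul_eq_mul]
      nlinarith
    let cut : Finset (Fin M) := Finset.univ.filter fun α => (φ u + α) / M ≠ (φ v + α) / M
    have hcard : (cut.card : ℝ) * h u ≤ 8 * M * F.wt v := by
      have h1 : cut.card ≤ ⌈4 * M * F.wt v / h u⌉₊ := by
        have := card_filter_shift_le (M := M) (φ u) ⌈4 * M * F.wt v / h u⌉₊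
        rwa [← hφ v u hvu] at this
      obtain hw1 | hw1 := hw0.eq_or_lt
      · rw [← hw1] at h1 ⊢
        have : cut.card = 0 := by simpa using h1
        simp [this]
      have h2 : 1 ≤ 4 * M * F.wt v / h u := by
        rw [le_div_iff₀ hu, one_mul]
        exact hMw v u hvu hu hw1
      have h3 := Nat.ceil_lt_add_one (zero_le_one.trans h2)
      have h4 : (cut.card : ℝ) ≤ 2 * (4 * M * F.wt v / h u) := by
        have : (cut.card : ℝ) ≤ ⌈4 * M * F.wt v / h u⌉₊ := by exact_mod_cast h1
        linarith
      calc (cut.card : ℝ) * h u ≤ 2 * (4 * M * F.wt v / h u) * h u :=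
            mul_le_mul_of_nonneg_right h4 hu.le
        _ = 8 * M * F.wt v := by field_simp; ring
    refine ⟨fun α => F.wt v + if α ∈ cut then 8 * h u + 4 * F.wt v else 0, fun α => ?_, ?_⟩
    · by_cases hα : α ∈ cut
      · simp only [hα, if_true]
        exact (hcut α).mono (by linarith)
      · simp only [hα, if_false, add_zero]
        refine .single (IsSpine.graft_step_of_keeps hF hvu ⟨u, hvu, hu, ?_⟩)
        simpa [cut] using hα
    · rw [Finset.sum_add_distrib, Finset.sum_ite_mem, Finset.univ_inter]
      simp only [Finset.sum_const, Finset.card_univ, Fintype.card_fin, nsmul_eq_mul]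
      have : (cut.card : ℝ) ≤ M := by
        exact_mod_cast (Finset.card_le_univ cut).trans (by simp)
      nlinarith
  refine ⟨G, fun α => hS.graft_valid hF hR', fun v p hp c hc α => ?_, fun u v c huv => ?_⟩
  · have h0 : h p ≤ 0 := hS.le p p hp 0 (.refl _ le_rfl)
    exact (hS.graft_reach hF hlen hM hφ hc).mono (by linarith)
  · induction huv with
    | @refl u c h0 =>
      exact ⟨fun _ => 0, fun α => .refl _ le_rfl, by simp; positivity⟩
    | @cons u v w a b hs _ ih =>
      obtain ⟨c₂, h₂, hc₂⟩ := ih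
      obtain ⟨c₁, h₁, hc₁⟩ : ∃ c' : Fin M → ℝ, (∀ α, Reach (G α).step u v (c' α)) ∧
          ∑ α, c' α ≤ 70 * M * a := by
        obtain ⟨hs, rfl⟩ | ⟨hs, rfl⟩ := hs
        · exact hedge _ _ hs
        · obtain ⟨c', h1, h2⟩ := hedge _ _ hs
          exact ⟨c', fun α => (h1 α).symm Forest.step_symm, h2⟩
      refine ⟨fun α => c₁ α + c₂ α, fun α => (h₁ α).trans (h₂ α), ?_⟩
      rw [Finset.sum_add_distrib]
      linarith

end Graft

section Embedding

variable {V : Type*} {H : SimpleGraph V} {len : Sym2 V → ℝ} {a b : V → ℕ}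

theorem ncard_support_avoid_le [Finite V] {P : Set V} {k i : ℕ}
    (hP : ∀ v, a v ≤ i → i ≤ b v → ∃ p ∈ P, H.Reachable v p ∧ a p ≤ i ∧ i ≤ b p)
    (hk : {v | v ∈ H.support ∧ a v ≤ i ∧ i ≤ b v}.ncard ≤ k + 1) :
    {v | v ∈ (H.avoid P).support ∧ a v ≤ i ∧ i ≤ b v}.ncard ≤ k := by
  obtain hemp | ⟨v, hv, hav, hbv⟩ :=
    {v | v ∈ (H.avoid P).support ∧ a v ≤ i ∧ i ≤ b v}.eq_empty_or_nonempty
  · simp [hemp]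
  obtain ⟨p, hp, ⟨w⟩, hap, hbp⟩ := hP v hav hbv
  have hvP : v ∉ P := by
    obtain ⟨x, hx⟩ := hv
    exact hx.2.1
  have hpH : p ∈ H.support := by
    cases w.reverse with
    | nil => exact absurd hp hvP
    | cons hadj _ => exact ⟨_, hadj⟩
  refine Nat.le_of_lt_succ (lt_of_lt_of_le (Set.ncard_lt_ncard ⟨?_, fun hsub => ?_⟩) hk)
  · rintro x ⟨⟨y, hxy⟩, hx⟩
    exact ⟨⟨y, hxy.1⟩, hx⟩
  · obtain ⟨⟨y, hy⟩, -⟩ := hsub ⟨hpH, hap, hbp⟩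
    exact hy.2.1 hp

/-- Metric graphs with interval representations of bounded width embed stochastically into
forests. -/
theorem exists_forests [Finite V] (hlen : ∀ e, 0 ≤ len e) (hab : ∀ v, a v ≤ b v) (k : ℕ)
    (H : SimpleGraph V) (hadj : ∀ u v, H.Adj u v → a u ≤ b v)
    (hk : ∀ i, {v | v ∈ H.support ∧ a v ≤ i ∧ i ≤ b v}.ncard ≤ k) :
    ∃ (Ω : Type) (_ : Fintype Ω) (_ : Nonempty Ω) (F : Ω → Forest V),
      (∀ ω, (F ω).Valid H len) ∧ ∀ u v, H.Adj u v → ∃ c : Ω → ℝ,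
        (∀ ω, Reach (F ω).step u v (c ω)) ∧
        ∑ ω, c ω ≤ 70 ^ k * Fintype.card Ω * len s(u, v) := by
  induction k generalizing H with
  | zero =>
    refine ⟨Unit, inferInstance, inferInstance, fun _ => ⟨fun _ => none, fun _ => 0, fun _ => 0⟩,
      by simp [Forest.Valid], fun u v huv => ?_⟩
    have h0 := hk (a u)
    rw [Nat.le_zero, Set.ncard_eq_zero] at h0
    exact absurd (show u ∈ (∅ : Set V) from h0 ▸ ⟨⟨v, huv⟩, le_rfl, hab u⟩) id
  | succ k ih =>
    obtain ⟨S, P, hSv, hSP, hiso, hPr, hhit⟩ := exists_spine hlen hadj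
    obtain ⟨h, π, hπ⟩ := exists_projection hlen hPr
    have hS : IsSpine H len S P h π :=
      ⟨hSv, fun v u hvu => (hSP v u hvu).2, hiso, fun v u hvu => (hSP v u hvu).1,
        fun v => (hπ v).1, fun v => (hπ v).2.1, fun v => (hπ v).2.2.1, fun v => (hπ v).2.2.2⟩
    obtain ⟨Ω, _, _, F, hF, hcost⟩ := ih (H.avoid P) (fun u v huv => hadj u v huv.1) fun i =>
      ncard_support_avoid_le (fun v => hhit v i) (hk i)
    obtain ⟨B, hB⟩ := (Set.finite_range fun x : Ω × V × V =>
      h x.2.2 / (4 * (F x.1).wt x.2.1)).bddAbove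
    obtain ⟨M, hMB⟩ := exists_nat_ge B
    have hMw : ∀ ω v u, (F ω).par v = some u → 0 < h u → 0 < (F ω).wt v →
        h u ≤ 4 * (M + 1 : ℕ) * (F ω).wt v := by
      intro ω v u _ _ hw
      have h1 : h u / (4 * (F ω).wt v) ≤ B := hB ⟨(ω, v, u), rfl⟩
      rw [div_le_iff₀ (by positivity)] at h1
      push_cast
      nlinarith
    choose G hG hGP hGc using fun ω =>
      hS.exists_grafts (hF ω) hlen M.succ_pos (hMw ω)
    refine ⟨Ω × Fin (M + 1), inferInstance, inferInstance, fun x => G x.1 x.2,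
      fun x => hG x.1 x.2, fun u v huv => ?_⟩
    have hl := hlen s(u, v)
    have hr : Reach (edgeStep H len) u v (len s(u, v)) := .single ⟨huv, rfl⟩
    by_cases hP : u ∈ P ∨ v ∈ P
    · refine ⟨fun _ => 5 * len s(u, v), fun x => ?_, ?_⟩
      · obtain hu | hv := hP
        · exact (hGP x.1 v u hu _ (hr.symm edgeStep_symm) x.2).symm Forest.step_symm
        · exact hGP x.1 u v hv _ hr x.2
      · simp only [Finset.sum_const, Finset.card_univ, nsmul_eq_mul]
        have h1 : (5 : ℝ) ≤ 70 ^ (k + 1) := by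
          have : (1 : ℝ) ≤ 70 ^ k := one_le_pow₀ (by norm_num)
          rw [pow_succ]
          linarith
        have h2 := mul_le_mul_of_nonneg_right h1
          (mul_nonneg (Nat.cast_nonneg (α := ℝ) (Fintype.card (Ω × Fin (M + 1)))) hl)
        linarith
    · rw [not_or] at hP
      obtain ⟨c, hc, hcs⟩ := hcost u v ⟨huv, hP⟩
      choose c' hc' hcs' using fun ω => hGc ω u v _ (hc ω)
      refine ⟨fun x => c' x.1 x.2, fun x => hc' x.1 x.2, ?_⟩
      rw [Fintype.sum_prod_type]
      calc ∑ ω, ∑ α, c' ω α ≤ ∑ ω, 70 * ((M + 1 : ℕ) : ℝ) * c ω :=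
            Finset.sum_le_sum fun ω _ => hcs' ω
        _ = 70 * ((M + 1 : ℕ) : ℝ) * ∑ ω, c ω := by rw [Finset.mul_sum]
        _ ≤ 70 * ((M + 1 : ℕ) : ℝ) * (70 ^ k * Fintype.card Ω * len s(u, v)) :=
            mul_le_mul_of_nonneg_left hcs (by positivity)
        _ = _ := by
            rw [Fintype.card_prod, Fintype.card_fin]
            push_cast
            ring

theorem Reach.bind {A B : V → V → ℝ → Prop} (hAB : ∀ u v c, A u v c → Reach B u v c) {u v : V}
    {c : ℝ} (h : Reach A u v c) : Reach B u v c := by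
  induction h with
  | refl u h0 => exact .refl u h0
  | cons h _ ih => exact (hAB _ _ _ h).trans ih

theorem reach_iff_spDist_le [Finite V] (hH : H.Connected) (hlen : ∀ e, 0 ≤ len e) {u v : V}
    {c : ℝ} : Reach (edgeStep H len) u v c ↔ spDist H len u v ≤ c := by
  constructor
  · intro h
    obtain ⟨p, hp⟩ := h.exists_walk
    refine (csInf_le ⟨0, ?_⟩ (Set.mem_range_self p)).trans hp
    rintro _ ⟨q, rfl⟩
    exact (reach_of_walk len q).nonneg (edgeStep_nonneg hlen)
  · intro h
    obtain ⟨p, -, hp⟩ := exists_shortest_path hlen (hH.preconnected u v)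
    refine (reach_of_walk len p).mono (le_trans (le_csInf ⟨_, Set.mem_range_self p⟩ ?_) h)
    rintro _ ⟨q, rfl⟩
    exact hp _ (reach_of_walk len q)

theorem spDist_comm [Finite V] (hH : H.Connected) (hlen : ∀ e, 0 ≤ len e) (u v : V) :
    spDist H len u v = spDist H len v u :=
  have key : ∀ u v, spDist H len u v ≤ spDist H len v u := fun _ v =>
    (reach_iff_spDist_le hH hlen).1
      (((reach_iff_spDist_le hH hlen (u := v)).2 le_rfl).symm edgeStep_symm)
  (key u v).antisymm (key v u)

namespace Forest

variable {F : Forest V}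

/-- The underlying graph of a forest. -/
def graph (F : Forest V) : SimpleGraph V :=
  SimpleGraph.fromRel fun u v => F.par u = some v

theorem Valid.adj_of_step (hF : F.Valid H len) {u v : V} {c : ℝ} (h : F.step u v c) :
    F.graph.Adj u v := by
  have aux : ∀ {u v}, F.par u = some v → u ≠ v := by
    rintro u v h rfl
    exact lt_irrefl _ (hF u u h).1
  obtain ⟨h, -⟩ | ⟨h, -⟩ := h
  · exact ⟨aux h, .inl h⟩
  · exact ⟨(aux h).symm, .inr h⟩

theorem Valid.isTree [Finite V] (hF : F.Valid H len) (hH : H.Connected)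
    (hadj : ∀ u v, H.Adj u v → ∃ c, Reach F.step u v c) : F.graph.IsTree := by
  classical
  have := hH.nonempty
  have hstep : ∀ {u v c}, Reach F.step u v c → F.graph.Reachable u v := by
    intro u v c h
    induction h with
    | refl u _ => exact .refl u
    | cons h _ ih => exact (hF.adj_of_step h).reachable.trans ih
  have hconn : F.graph.Connected := by
    refine ⟨fun u v => ?_⟩
    obtain ⟨p⟩ := hH.preconnected u v
    induction p with
    | nil => exact .refl _
    | cons h _ ih =>
      obtain ⟨c, hc⟩ := hadj _ _ h
      exact (hstep hc).trans ih
  refine SimpleGraph.isTree_iff_connected_and_card.2 ⟨hconn, le_antisymm ?_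
    hconn.card_vert_le_card_edgeSet_add_one⟩
  obtain ⟨r, hr⟩ := Finite.exists_min F.rk
  have hroot : F.par r = none := by
    by_contra hne
    obtain ⟨u, hu⟩ := Option.ne_none_iff_exists'.1 hne
    exact absurd (hF r u hu).1 (hr u).not_gt
  have hsub : F.graph.edgeSet ⊆ (fun v => s(v, (F.par v).getD v)) '' {r}ᶜ := by
    intro e
    induction e with
    | _ u v =>
    rintro ⟨-, h | h⟩
    · exact ⟨u, by rintro rfl; simp [hroot] at h, by simp [h]⟩
    · exact ⟨v, by rintro rfl; simp [hroot] at h, by simp [h, Sym2.eq_swap]⟩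
  have h1 := (Set.ncard_le_ncard hsub).trans (Set.ncard_image_le (Set.toFinite _))
  have h2 := Set.ncard_add_ncard_compl ({r} : Set V)
  rw [Set.ncard_singleton] at h2
  rw [Nat.card_coe_set_eq]
  omega

/-- A spanning forest of a connected metric graph, with edge lengths given by the distances of
that metric graph, induces a larger metric, bounded by the costs in the forest. -/
theorem Valid.exists_tree_metric [Finite V] (hF : F.Valid H len) (hH : H.Connected)
    (hlen : ∀ e, 0 ≤ len e) (hadj : ∀ u v, H.Adj u v → ∃ c, Reach F.step u v c) :
    ∃ len' : Sym2 V → ℝ, (∀ e, 0 ≤ len' e) ∧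
      (∀ u v, spDist H len u v ≤ spDist F.graph len' u v) ∧
      ∀ u v c, Reach F.step u v c → spDist F.graph len' u v ≤ c := by
  let len' : Sym2 V → ℝ := Sym2.lift ⟨spDist H len, spDist_comm hH hlen⟩
  have hd : ∀ {u v c}, Reach (edgeStep H len) u v c ↔ spDist H len u v ≤ c :=
    reach_iff_spDist_le hH hlen
  have hlen' : ∀ e, 0 ≤ len' e := by
    intro e
    induction e with
    | _ u v => exact (hd.2 le_rfl).nonneg (edgeStep_nonneg hlen)
  have hT := hF.isTree hH hadj
  refine ⟨len', hlen', fun u v => ?_, fun u v c huv => ?_⟩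
  · rw [← hd]
    refine ((reach_iff_spDist_le hT.connected hlen').2 le_rfl).bind ?_
    rintro x y c ⟨-, rfl⟩
    exact hd.2 le_rfl
  · rw [← reach_iff_spDist_le hT.connected hlen']
    refine huv.bind fun x y c h => ?_
    have hxy : Reach (edgeStep H len) x y c := by
      obtain ⟨h, rfl⟩ | ⟨h, rfl⟩ := h
      · exact (hF _ _ h).2
      · exact (hF _ _ h).2.symm edgeStep_symm
    exact (Reach.single ⟨hF.adj_of_step h, rfl⟩).mono (hd.1 hxy)

end Forest

theorem stochEmbeds_treeFam {n : ℕ} {G : SimpleGraph (Fin n)} (hG : G.Connected)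
    {len : Sym2 (Fin n) → ℝ} (hlen : ∀ e, 0 ≤ len e) {a b : Fin n → ℕ} (hab : ∀ v, a v ≤ b v)
    (hadj : ∀ u v, G.Adj u v → a u ≤ b v) {k : ℕ}
    (hk : ∀ i, {v | a v ≤ i ∧ i ≤ b v}.ncard ≤ k) :
    StochEmbeds (spDist G len) (SupportedMetrics TreeFam) (70 ^ k) := by
  obtain ⟨Ω, _, _, F, hF, hcost⟩ := exists_forests hlen hab k G hadj fun i =>
    (Set.ncard_le_ncard fun v hv => hv.2).trans (hk i)
  have hedge : ∀ ω u v, G.Adj u v → ∃ c, Reach (F ω).step u v c := fun ω u v huv =>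
    let ⟨c, hc, _⟩ := hcost u v huv
    ⟨c ω, hc ω⟩
  choose lenT hlenT hdom hle using fun ω => (hF ω).exists_tree_metric hG hlen (hedge ω)
  have hsum : ∀ u v c, Reach (edgeStep G len) u v c → ∃ c' : Ω → ℝ,
      (∀ ω, Reach (F ω).step u v (c' ω)) ∧ ∑ ω, c' ω ≤ 70 ^ k * Fintype.card Ω * c := by
    intro u v c h
    induction h with
    | refl u h0 => exact ⟨fun _ => 0, fun _ => .refl _ le_rfl, by simp; positivity⟩
    | cons h _ ih =>
      obtain ⟨h, rfl⟩ := h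
      obtain ⟨c₁, h₁, hc₁⟩ := hcost _ _ h
      obtain ⟨c₂, h₂, hc₂⟩ := ih
      refine ⟨fun ω => c₁ ω + c₂ ω, fun ω => (h₁ ω).trans (h₂ ω), ?_⟩
      rw [Finset.sum_add_distrib]
      linarith
  have hN : (0 : ℝ) < Fintype.card Ω := by exact_mod_cast Fintype.card_pos
  let e := (Fintype.equivFin Ω).symm
  refine ⟨Fintype.card Ω, fun _ => (Fintype.card Ω : ℝ)⁻¹,
    fun i => ⟨n, spDist (F (e i)).graph (lenT (e i))⟩, fun _ v => v, fun _ => by positivity,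
    by simp [hN.ne'], fun i _ => ?_, fun i _ => hdom (e i), fun u v => ?_⟩
  · have hT := (hF (e i)).isTree hG (hedge (e i))
    exact ⟨_, hT, hT.connected, _, hlenT (e i), fun _ _ => rfl⟩
  · obtain ⟨c, hc, hcs⟩ := hsum u v _ ((reach_iff_spDist_le hG hlen).2 le_rfl)
    rw [← Finset.mul_sum, inv_mul_le_iff₀ hN]
    calc ∑ i, spDist (F (e i)).graph (lenT (e i)) u v
        = ∑ ω, spDist (F ω).graph (lenT ω) u v :=
          e.sum_comp fun ω => spDist (F ω).graph (lenT ω) u v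
      _ ≤ ∑ ω, c ω := Finset.sum_le_sum fun ω _ => hle ω u v _ (hc ω)
      _ ≤ 70 ^ k * Fintype.card Ω * spDist G len u v := hcs
      _ = _ := by ring

end Embedding

/-- **Corollary.** For every tree `T` there is a constant `D = D(T)` such that every
shortest-path metric supported on a `T`-minor-free graph admits a stochastic `D`-embedding into
the shortest-path metrics supported on trees: `𝓔{T} ⇝ Trees`. -/
theorem excluded_tree_into_trees (m : ℕ) (T : SimpleGraph (Fin m)) (hT : T.IsTree) :
    ∃ D : ℝ, 1 ≤ D ∧
      ∀ Y ∈ SupportedMetrics (fun n => {G : SimpleGraph (Fin n) | ¬ IsMinor T G}),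
        StochEmbeds Y.2 (SupportedMetrics TreeFam) D := by
  have h70 : (1 : ℝ) ≤ 70 := by norm_num
  refine ⟨70 ^ 2 ^ (2 * m), one_le_pow₀ h70, ?_⟩
  rintro ⟨n, d⟩ ⟨G, hTG, hG, len, hlen, hd⟩
  change Fin n → Fin n → ℝ at d
  change SimpleGraph (Fin n) at G
  change Sym2 (Fin n) → ℝ at len
  change ∀ u v, d u v = spDist G len u v at hd
  change StochEmbeds d _ _
  rw [show d = spDist G len from funext fun u => funext fun v => hd u v]
  obtain ⟨a, b, hab, hadj, hk⟩ := exists_intervals_of_not_isMinor hT hTG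
  rw [Fintype.card_fin] at hk
  exact stochEmbeds_treeFam hG hlen hab hadj hk
end

section
/- For every integer k ≥ 1 there is NO constant D such that every shortest-path metric supported on a tree of pathwidth at most k+1 admits a stochastic D-embedding into the family of shortest-path metrics supported on graphs of pathwidth at most k. In symbols, Pathwidth(k+1) ∩ Trees ⇝̸ Pathwidth(k). -/
open scoped BigOperators

section WalkLength

variable {V W : Type*} {G : SimpleGraph V} {len : Sym2 V → ℝ}

/-- The total length of a walk. -/
noncomputable def walkLength (len : Sym2 V → ℝ) {u v : V} (w : G.Walk u v) : ℝ :=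
  (w.edges.map len).sum

@[simp] theorem walkLength_nil (u : V) :
    walkLength len (SimpleGraph.Walk.nil : G.Walk u u) = 0 := by
  simp [walkLength]

@[simp] theorem walkLength_cons {u v x : V} (h : G.Adj u v) (w : G.Walk v x) :
    walkLength len (SimpleGraph.Walk.cons h w) = len s(u, v) + walkLength len w := by
  simp [walkLength]

theorem walkLength_append {u v x : V} (p : G.Walk u v) (q : G.Walk v x) :
    walkLength len (p.append q) = walkLength len p + walkLength len q := by
  simp [walkLength, SimpleGraph.Walk.edges_append]

theorem walkLength_reverse {u v : V} (p : G.Walk u v) :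
    walkLength len p.reverse = walkLength len p := by
  simp [walkLength, SimpleGraph.Walk.edges_reverse]

theorem walkLength_nonneg (hl : ∀ e, 0 ≤ len e) {u v : V} (p : G.Walk u v) :
    0 ≤ walkLength len p := by
  induction p with
  | nil => simp
  | cons h p ih => rw [walkLength_cons]; exact add_nonneg (hl _) ih

theorem spDist_le_walkLength (hl : ∀ e, 0 ≤ len e) {u v : V} (p : G.Walk u v) :
    spDist G len u v ≤ walkLength len p :=
  csInf_le (s := Set.range fun w : G.Walk u v => (w.edges.map len).sum)
    ⟨0, by rintro _ ⟨q, rfl⟩; exact walkLength_nonneg hl q⟩ ⟨p, rfl⟩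

theorem le_spDist (hc : G.Connected) {u v : V} {c : ℝ}
    (h : ∀ p : G.Walk u v, c ≤ walkLength len p) : c ≤ spDist G len u v := by
  obtain ⟨p⟩ := hc.preconnected u v
  exact le_csInf ⟨_, p, rfl⟩ (by rintro _ ⟨q, rfl⟩; exact h q)

theorem exists_walkLength_lt (hc : G.Connected) {u v : V} {c : ℝ}
    (h : spDist G len u v < c) : ∃ p : G.Walk u v, walkLength len p < c := by
  obtain ⟨p⟩ := hc.preconnected u v
  obtain ⟨_, ⟨q, rfl⟩, hq⟩ := exists_lt_of_csInf_lt (Set.range_nonempty_iff_nonempty.2 ⟨p⟩) h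
  exact ⟨q, hq⟩

theorem spDist_nonneg (hl : ∀ e, 0 ≤ len e) (u v : V) : 0 ≤ spDist G len u v :=
  Real.sInf_nonneg (by rintro _ ⟨q, rfl⟩; exact walkLength_nonneg hl q)

theorem spDist_self (hl : ∀ e, 0 ≤ len e) (u : V) : spDist G len u u = 0 :=
  le_antisymm (by simpa using spDist_le_walkLength hl (SimpleGraph.Walk.nil : G.Walk u u))
    (spDist_nonneg hl u u)

theorem spDist_le_of_adj (hl : ∀ e, 0 ≤ len e) {u v : V} (h : G.Adj u v) :
    spDist G len u v ≤ len s(u, v) := by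
  simpa using spDist_le_walkLength hl (SimpleGraph.Walk.cons h .nil)

theorem spDist_comm_s4 (hc : G.Connected) (hl : ∀ e, 0 ≤ len e) (u v : V) :
    spDist G len u v = spDist G len v u := by
  have key : ∀ u v : V, spDist G len u v ≤ spDist G len v u := fun u v =>
    le_spDist hc fun p => walkLength_reverse (len := len) p ▸ spDist_le_walkLength hl p.reverse
  exact le_antisymm (key u v) (key v u)

theorem spDist_triangle (hc : G.Connected) (hl : ∀ e, 0 ≤ len e) (u v x : V) :
    spDist G len u x ≤ spDist G len u v + spDist G len v x := by
  rw [← sub_le_iff_le_add]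
  refine le_spDist hc fun q => ?_
  rw [sub_le_comm]
  refine le_spDist hc fun p => ?_
  rw [sub_le_iff_le_add, add_comm, ← walkLength_append]
  exact spDist_le_walkLength hl _

/-- A distance-like function bounded by the edge lengths is bounded by the path metric. -/
theorem le_spDist_of_adj (hc : G.Connected) (e : V → V → ℝ) (h0 : ∀ x, e x x ≤ 0)
    (ht : ∀ x y z, e x z ≤ e x y + e y z) (ha : ∀ x y, G.Adj x y → e x y ≤ len s(x, y))
    (u v : V) : e u v ≤ spDist G len u v := by
  refine le_spDist hc fun p => ?_
  induction p with
  | nil => simpa using h0 _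
  | @cons a b c h p ih => rw [walkLength_cons]; linarith [ht a b c, ha a b h]

theorem spDist_le_walkLength_of_mem_support (hc : G.Connected) (hl : ∀ e, 0 ≤ len e)
    {u v x : V} (p : G.Walk u v) (hx : x ∈ p.support) : spDist G len u x ≤ walkLength len p := by
  induction p with
  | nil =>
    simp only [SimpleGraph.Walk.support_nil, List.mem_singleton] at hx
    simp [hx, spDist_self hl]
  | @cons a b c h p ih =>
    rw [walkLength_cons]
    rw [SimpleGraph.Walk.support_cons, List.mem_cons] at hx
    rcases hx with rfl | hx
    · rw [spDist_self hl]
      exact add_nonneg (hl _) (walkLength_nonneg hl p)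
    · linarith [ih hx, spDist_triangle hc hl a b x, spDist_le_of_adj hl h]

/-- A walk visiting many pairwise far apart vertices is long. -/
theorem exists_spDist_add_le_walkLength (hc : G.Connected) (hl : ∀ e, 0 ≤ len e) {L : ℝ}
    {u v : V} (p : G.Walk u v) (S : Finset V) (hne : S.Nonempty) (hS : ∀ x ∈ S, x ∈ p.support)
    (hsep : ∀ x ∈ S, ∀ y ∈ S, x ≠ y → L ≤ spDist G len x y) :
    ∃ s ∈ S, spDist G len u s + ((S.card : ℝ) - 1) * L ≤ walkLength len p := by
  classical
  induction p generalizing S with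
  | @nil u =>
    have hS' : S = {u} := by
      refine Finset.eq_singleton_iff_nonempty_unique_mem.2 ⟨hne, fun x hx => ?_⟩
      simpa using hS x hx
    subst hS'
    exact ⟨u, by simp, by simp [spDist_self hl]⟩
  | @cons a b c h p ih =>
    rw [walkLength_cons]
    have hab := spDist_le_of_adj hl h
    by_cases ha : a ∈ S
    · refine ⟨a, ha, ?_⟩
      rw [spDist_self hl]
      rcases (S.erase a).eq_empty_or_nonempty with he | hne'
      · have hcard : S.card = 1 := by
          have := Finset.card_erase_add_one ha
          simpa [he] using this.symm
        simp only [hcard, Nat.cast_one, sub_self, zero_mul, add_zero]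
        exact add_nonneg (hl _) (walkLength_nonneg hl p)
      · obtain ⟨s, hs, hle⟩ := ih (S.erase a) hne'
          (fun x hx => by
            have := hS x (Finset.mem_of_mem_erase hx)
            rw [SimpleGraph.Walk.support_cons, List.mem_cons] at this
            exact this.resolve_left (Finset.ne_of_mem_erase hx))
          (fun x hx y hy => hsep x (Finset.mem_of_mem_erase hx) y (Finset.mem_of_mem_erase hy))
        have hcard : ((S.erase a).card : ℝ) = S.card - 1 := by
          rw [← Finset.card_erase_add_one ha]; simp
        rw [hcard] at hle
        have := hsep a ha s (Finset.mem_of_mem_erase hs) (Finset.ne_of_mem_erase hs).symm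
        linarith [spDist_triangle hc hl a b s]
    · obtain ⟨s, hs, hle⟩ := ih S hne
        (fun x hx => by
          have := hS x hx
          rw [SimpleGraph.Walk.support_cons, List.mem_cons] at this
          exact this.resolve_left (by rintro rfl; exact ha hx)) hsep
      exact ⟨s, hs, by linarith [spDist_triangle hc hl a b s]⟩

/-- A walk between two bags of a path decomposition meets every bag in between. -/
theorem IsPathDecomp.exists_mem_support {t : ℕ} {X : Fin t → Finset V} (hX : IsPathDecomp G t X)
    {u v : V} (p : G.Walk u v) {i j l : Fin t} (hu : u ∈ X i) (hv : v ∈ X j) (hil : i ≤ l)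
    (hlj : l ≤ j) : ∃ x ∈ p.support, x ∈ X l := by
  induction p generalizing i with
  | nil => exact ⟨_, by simp, hX.2.2 _ i l j hil hlj hu hv⟩
  | @cons a b c h p ih =>
    obtain ⟨i', ha, hb⟩ := hX.2.1 h
    rcases le_total l i' with hl | hl
    · exact ⟨a, by simp, hX.2.2 _ i l i' hil hl hu ha⟩
    · obtain ⟨x, hx, hx'⟩ := ih hb hv hl
      exact ⟨x, by simp [hx], hx'⟩

end WalkLength

/-! ### Joining copies of a rooted tree to a new root -/

section Broom

variable {V : Type*} (m : ℕ) (G : SimpleGraph V) (r : V)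

/-- `m` disjoint copies of `G`, with the roots of all copies joined to a new vertex `none`. -/
def broom : SimpleGraph (Option (Fin m × V)) where
  Adj
    | none, none => False
    | none, some q => q.2 = r
    | some p, none => p.2 = r
    | some p, some q => p.1 = q.1 ∧ G.Adj p.2 q.2
  symm := ⟨by
    rintro (_ | p) (_ | q) h
    · exact h
    · exact h
    · exact h
    · exact ⟨h.1.symm, h.2.symm⟩⟩
  loopless := ⟨by
    rintro (_ | p) h
    · exact h
    · exact G.loopless.irrefl _ h.2⟩

open Classical in
/-- The projection of the broom onto its `a`-th copy, collapsing everything else to the root. -/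
noncomputable def broomProj (a : Fin m) : Option (Fin m × V) → V
  | none => r
  | some p => if p.1 = a then p.2 else r

open Classical in
/-- Edge lengths on the broom: `L` on the edges at the new root, inherited on the copies. -/
noncomputable def broomLen (len : Sym2 V → ℝ) (L : ℝ) (e : Sym2 (Option (Fin m × V))) : ℝ :=
  if none ∈ e then L else len (e.map fun o => o.elim r Prod.snd)

variable {m G r}

@[simp] theorem broomProj_some (a : Fin m) (x : V) : broomProj m r a (some (a, x)) = x := by
  simp [broomProj]

theorem broomLen_nonneg {len : Sym2 V → ℝ} {L : ℝ} (hl : ∀ e, 0 ≤ len e) (hL : 0 ≤ L) (e) :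
    0 ≤ broomLen m r len L e := by
  unfold broomLen
  split_ifs
  · exact hL
  · exact hl _

@[simp] theorem broomLen_none_some {len : Sym2 V → ℝ} {L : ℝ} (q : Fin m × V) :
    broomLen m r len L s(none, some q) = L := by
  simp [broomLen]

@[simp] theorem broomLen_some_none {len : Sym2 V → ℝ} {L : ℝ} (q : Fin m × V) :
    broomLen m r len L s(some q, none) = L := by
  simp [broomLen]

@[simp] theorem broomLen_some_some {len : Sym2 V → ℝ} {L : ℝ} (p q : Fin m × V) :
    broomLen m r len L s(some p, some q) = len s(p.2, q.2) := by
  simp [broomLen]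

theorem broomProj_eq_or_adj (a : Fin m) {x y : Option (Fin m × V)} (h : (broom m G r).Adj x y) :
    broomProj m r a x = broomProj m r a y ∨
      ∃ x' y', x = some (a, x') ∧ y = some (a, y') ∧ G.Adj x' y' := by
  rcases x with _ | ⟨b, x⟩ <;> rcases y with _ | ⟨c, y⟩
  · exact h.elim
  · obtain rfl : y = r := h
    left; simp [broomProj]
  · obtain rfl : x = r := h
    left; simp [broomProj]
  · obtain ⟨rfl, h⟩ : b = c ∧ G.Adj x y := h
    by_cases hb : b = a
    · subst hb
      exact Or.inr ⟨x, y, rfl, rfl, h⟩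
    · left; simp [broomProj, hb]

/-- The inclusion of a copy of `G`. -/
def broomHom (G : SimpleGraph V) (r : V) (a : Fin m) : G →g broom m G r where
  toFun x := some (a, x)
  map_rel' h := ⟨rfl, h⟩

theorem broom_connected (hG : G.Connected) : (broom m G r).Connected := by
  have key : ∀ x, (broom m G r).Reachable none x := by
    rintro (_ | ⟨a, x⟩)
    · rfl
    · have h1 : (broom m G r).Adj none (some (a, r)) := rfl
      exact h1.reachable.trans ((hG.preconnected r x).map (broomHom G r a))
  exact ⟨fun x y => (key x).symm.trans (key y)⟩

theorem SimpleGraph.Reachable.of_forall_adj {V W : Type*} {G : SimpleGraph V} {H : SimpleGraph W}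
    {f : V → W} (h : ∀ x y, G.Adj x y → H.Reachable (f x) (f y)) {x y : V}
    (hxy : G.Reachable x y) : H.Reachable (f x) (f y) := by
  obtain ⟨p⟩ := hxy
  induction p with
  | nil => rfl
  | cons hadj p ih => exact (h _ _ hadj).trans ih

theorem broom_isTree (hG : G.IsTree) : (broom m G r).IsTree := by
  refine ⟨broom_connected hG.connected, SimpleGraph.isAcyclic_iff_forall_adj_isBridge.2 ?_⟩
  have hroot : ∀ a : Fin m, (broom m G r).IsBridge s(none, some (a, r)) := by
    intro a
    rw [SimpleGraph.isBridge_iff]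
    intro hreach
    let f : Option (Fin m × V) → Prop := fun o => ∃ x, o = some (a, x)
    have := hreach.of_forall_adj (H := (⊥ : SimpleGraph Prop)) (f := f) (by
      intro x y hxy
      rw [SimpleGraph.reachable_bot]
      rw [SimpleGraph.deleteEdges_adj] at hxy
      obtain ⟨h, hne⟩ := hxy
      rcases x with _ | ⟨b, x⟩ <;> rcases y with _ | ⟨c, y⟩
      · exact h.elim
      · obtain rfl : y = r := h
        have : c ≠ a := by rintro rfl; simp at hne
        simp [f, this]
      · obtain rfl : x = r := h
        have : b ≠ a := by rintro rfl; simp at hne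
        simp [f, this]
      · obtain ⟨rfl, h⟩ : b = c ∧ G.Adj x y := h
        simp [f])
    rw [SimpleGraph.reachable_bot] at this
    simp [f] at this
  rintro (_ | ⟨a, x⟩) (_ | ⟨b, y⟩) h
  · exact h.elim
  · obtain rfl : y = r := h
    exact hroot b
  · obtain rfl : x = r := h
    rw [Sym2.eq_swap]
    exact hroot a
  · obtain ⟨rfl, h⟩ : a = b ∧ G.Adj x y := h
    rw [SimpleGraph.isBridge_iff]
    intro hreach
    have hbr := SimpleGraph.isAcyclic_iff_forall_adj_isBridge.1 hG.isAcyclic h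
    rw [SimpleGraph.isBridge_iff] at hbr
    refine hbr ?_
    have := hreach.of_forall_adj (H := G.deleteEdges {s(x, y)}) (f := broomProj m r a) (by
      intro u v huv
      rw [SimpleGraph.deleteEdges_adj] at huv
      rcases broomProj_eq_or_adj a huv.1 with h' | ⟨u, v, rfl, rfl, h'⟩
      · rw [h']
      · refine SimpleGraph.Adj.reachable ?_
        rw [SimpleGraph.deleteEdges_adj]
        refine ⟨by simpa using h', ?_⟩
        simpa using huv.2)
    simpa using this

theorem spDist_broom_copy_le {len : Sym2 V → ℝ} {L : ℝ} (hc : G.Connected) (hl : ∀ e, 0 ≤ len e)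
    (hL : 0 ≤ L) (a : Fin m) (x y : V) :
    spDist (broom m G r) (broomLen m r len L) (some (a, x)) (some (a, y)) ≤ spDist G len x y := by
  have hl' := broomLen_nonneg (m := m) (r := r) hl hL
  have hc' := broom_connected (m := m) (r := r) hc
  refine le_spDist_of_adj hc
    (fun x y => spDist (broom m G r) (broomLen m r len L) (some (a, x)) (some (a, y)))
    (fun x => (spDist_self hl' _).le) (fun x y z => spDist_triangle hc' hl' _ _ _)
    (fun x y h => ?_) x y
  have h' : (broom m G r).Adj (some (a, x)) (some (a, y)) := ⟨rfl, h⟩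
  simpa using spDist_le_of_adj hl' h'

theorem spDist_le_spDist_broom_copy {len : Sym2 V → ℝ} {L : ℝ} (hc : G.Connected)
    (hl : ∀ e, 0 ≤ len e) (hL : 0 ≤ L) (a : Fin m) (x y : V) :
    spDist G len x y ≤ spDist (broom m G r) (broomLen m r len L) (some (a, x)) (some (a, y)) := by
  have hl' := broomLen_nonneg (m := m) (r := r) hl hL
  have := le_spDist_of_adj (broom_connected (m := m) (r := r) hc)
    (len := broomLen m r len L)
    (fun x y => spDist G len (broomProj m r a x) (broomProj m r a y))
    (fun x => (spDist_self hl _).le) (fun x y z => spDist_triangle hc hl _ _ _)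
    (fun x y h => by
      rcases broomProj_eq_or_adj a h with h' | ⟨u, v, rfl, rfl, h'⟩
      · simp only [h']
        rw [spDist_self hl]
        exact hl' _
      · simpa using spDist_le_of_adj hl h') (some (a, x)) (some (a, y))
  simpa using this

theorem le_spDist_broom_of_ne {len : Sym2 V → ℝ} {L : ℝ} (hc : G.Connected)
    (hl : ∀ e, 0 ≤ len e) (hL : 0 ≤ L) {a b : Fin m} (hab : a ≠ b) (x y : V) :
    L ≤ spDist (broom m G r) (broomLen m r len L) (some (a, x)) (some (b, y)) := by
  let f : Option (Fin m × V) → ℝ := fun o => o.elim 0 fun p => if p.1 = a then L else 0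
  have := le_spDist_of_adj (broom_connected (m := m) (r := r) hc)
    (len := broomLen m r len L) (fun x y => f x - f y) (fun x => by simp) (fun x y z => by simp)
    (fun x y h => by
      rcases x with _ | ⟨c, x⟩ <;> rcases y with _ | ⟨d, y⟩
      · exact h.elim
      · rw [broomLen_none_some]
        simp only [f, Option.elim]
        split_ifs <;> linarith
      · rw [broomLen_some_none]
        simp only [f, Option.elim]
        split_ifs <;> linarith
      · obtain ⟨rfl, h⟩ : c = d ∧ G.Adj x y := h
        simpa [f] using hl _) (some (a, x)) (some (b, y))
  simpa [f, hab.symm] using this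

theorem spDist_broom_root_le {len : Sym2 V → ℝ} {L : ℝ} (hl : ∀ e, 0 ≤ len e) (hL : 0 ≤ L)
    (a : Fin m) : spDist (broom m G r) (broomLen m r len L) none (some (a, r)) ≤ L := by
  have h : (broom m G r).Adj none (some (a, r)) := rfl
  simpa using spDist_le_of_adj (broomLen_nonneg (m := m) (r := r) hl hL) h

/-- A path decomposition indexed by a finite linear order. -/
theorem pathwidthLE_of_linearOrder {W ι : Type*} [Fintype ι] [LinearOrder ι] {G : SimpleGraph W}
    {k : ℕ} (X : ι → Finset W) (hv : ∀ v, ∃ i, v ∈ X i)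
    (he : ∀ ⦃u v : W⦄, G.Adj u v → ∃ i, u ∈ X i ∧ v ∈ X i)
    (hi : ∀ (v : W) (i j l : ι), i ≤ j → j ≤ l → v ∈ X i → v ∈ X l → v ∈ X j)
    (hk : ∀ i, (X i).card ≤ k + 1) : pathwidthLE G k := by
  let e := Fintype.orderIsoFinOfCardEq ι rfl
  refine ⟨Fintype.card ι, fun i => X (e i), ⟨fun v => ?_, fun u v h => ?_, fun v i j l hij hjl => ?_⟩,
    fun i => hk _⟩
  · obtain ⟨i, h⟩ := hv v
    exact ⟨e.symm i, by simpa using h⟩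
  · obtain ⟨i, h⟩ := he h
    exact ⟨e.symm i, by simpa using h⟩
  · exact hi v _ _ _ (e.monotone hij) (e.monotone hjl)

theorem broom_pathwidthLE (hm : 0 < m) {k : ℕ} (h : pathwidthLE G k) :
    pathwidthLE (broom m G r) (k + 1) := by
  classical
  obtain ⟨t, X, hX, hk⟩ := h
  obtain ⟨inc, hinc⟩ : ∃ inc : Fin m → V ↪ Option (Fin m × V), ∀ a x, inc a x = some (a, x) :=
    ⟨fun a => ⟨fun x => some (a, x), fun x y h => by simpa using h⟩, fun _ _ => rfl⟩
  refine pathwidthLE_of_linearOrder (ι := Fin m ×ₗ Fin t)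
    (fun i => insert none ((X (ofLex i).2).map (inc (ofLex i).1))) ?_ ?_ ?_ ?_
  · rintro (_ | ⟨a, x⟩)
    · obtain ⟨i, -⟩ := hX.1 r
      exact ⟨toLex (⟨0, hm⟩, i), by simp⟩
    · obtain ⟨i, hi⟩ := hX.1 x
      exact ⟨toLex (a, i), by simpa [hinc] using hi⟩
  · rintro (_ | ⟨a, x⟩) (_ | ⟨b, y⟩) h
    · exact h.elim
    · obtain ⟨i, hi⟩ := hX.1 y
      exact ⟨toLex (b, i), by simpa [hinc] using hi⟩
    · obtain ⟨i, hi⟩ := hX.1 x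
      exact ⟨toLex (a, i), by simpa [hinc] using hi⟩
    · obtain ⟨rfl, h⟩ : a = b ∧ G.Adj x y := h
      obtain ⟨i, hi⟩ := hX.2.1 h
      exact ⟨toLex (a, i), by simpa [hinc] using hi⟩
  · rintro (_ | ⟨a, x⟩) i j l hij hjl hi hl
    · simp
    · simp only [hinc, Finset.mem_insert, reduceCtorEq, Finset.mem_map,
        Option.some.injEq, Prod.mk.injEq, false_or] at hi hl ⊢
      obtain ⟨x, hx, h1, rfl⟩ := hi
      obtain ⟨y, hy, h2, rfl⟩ := hl
      rw [Prod.Lex.le_iff] at hij hjl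
      have e1 : (ofLex i).1 = (ofLex j).1 := by
        rcases hij with h | h
        · rcases hjl with h' | h'
          · exact absurd (h.trans h') (by rw [h1, h2]; exact lt_irrefl _)
          · rw [h'.1, h1, h2]
        · exact h.1
      have e2 : (ofLex j).1 = (ofLex l).1 := by rw [← e1, h1, h2]
      refine ⟨y, hX.2.2 y (ofLex i).2 (ofLex j).2 (ofLex l).2 ?_ ?_ hx hy, e1 ▸ h1, rfl⟩
      · rcases hij with h | h
        · exact absurd e1 h.ne
        · exact h.2
      · rcases hjl with h | h
        · exact absurd e2 h.ne
        · exact h.2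
  · intro i
    refine (Finset.card_insert_le _ _).trans ?_
    simpa using hk _

end Broom

/-- Many well separated groups of vertices, all close to `c` and each containing `k + 1` vertices
of a common bag, force a bag with `k + 2` vertices close to `c`. -/
theorem IsPathDecomp.exists_larger_bag {W ι : Type*} {H : SimpleGraph W} {len : Sym2 W → ℝ}
    (hc : H.Connected) (hl : ∀ e, 0 ≤ len e) {t : ℕ} {X : Fin t → Finset W}
    (hX : IsPathDecomp H t X) {k : ℕ} {ρ R L : ℝ} (hρ : 0 ≤ ρ) (hR : 0 ≤ R) (hL : 2 * ρ < L)
    (I : Finset ι) (hI : I.Nonempty)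
    (hcard : 2 * ρ + 2 * R + 1 < ((I.card : ℝ) - 1) * (L - 2 * ρ)) (c : W) (q : ι → W)
    (hq : ∀ a ∈ I, spDist H len c (q a) ≤ R)
    (hsep : ∀ a ∈ I, ∀ b ∈ I, a ≠ b → L ≤ spDist H len (q a) (q b)) (bag : ι → Fin t)
    (S : ι → Finset W) (hS : ∀ a ∈ I, S a ⊆ X (bag a)) (hSk : ∀ a ∈ I, (S a).card = k + 1)
    (hSρ : ∀ a ∈ I, ∀ s ∈ S a, spDist H len (q a) s ≤ ρ) :
    ∃ i, ∃ S' ⊆ X i, S'.card = k + 2 ∧ ∀ s ∈ S', spDist H len c s ≤ 3 * R + 3 * ρ + 1 := by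
  classical
  obtain ⟨a₀, ha₀, hmin⟩ := I.exists_min_image bag hI
  obtain ⟨a₁, ha₁, hmax⟩ := I.exists_max_image bag hI
  have hSne : ∀ a ∈ I, (S a).Nonempty := fun a ha =>
    Finset.card_pos.1 (by rw [hSk a ha]; exact Nat.succ_pos k)
  obtain ⟨u, hu⟩ := hSne a₀ ha₀
  obtain ⟨v, hv⟩ := hSne a₁ ha₁
  have hcu : spDist H len c u ≤ R + ρ :=
    (spDist_triangle hc hl c (q a₀) u).trans (add_le_add (hq a₀ ha₀) (hSρ a₀ ha₀ u hu))
  have hcv : spDist H len c v ≤ R + ρ :=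
    (spDist_triangle hc hl c (q a₁) v).trans (add_le_add (hq a₁ ha₁) (hSρ a₁ ha₁ v hv))
  have huv : spDist H len u v < 2 * ρ + 2 * R + 1 := by
    have := spDist_triangle hc hl u c v
    rw [spDist_comm_s4 hc hl u c] at this
    linarith
  obtain ⟨p, hp⟩ := exists_walkLength_lt hc huv
  have hhit : ∀ a ∈ I, ∃ x ∈ p.support, x ∈ X (bag a) := fun a ha =>
    hX.exists_mem_support p (hS a₀ ha₀ hu) (hS a₁ ha₁ hv) (hmin a ha) (hmax a ha)
  have hnear : ∀ x ∈ p.support, spDist H len c x ≤ 3 * R + 3 * ρ + 1 := fun x hx => by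
    linarith [spDist_triangle hc hl c u x, spDist_le_walkLength_of_mem_support hc hl p hx]
  by_contra hcon
  have hmem : ∀ a ∈ I, ∀ x ∈ p.support, x ∈ X (bag a) → x ∈ S a := by
    intro a ha x hx hxa
    by_contra hxS
    refine hcon ⟨bag a, insert x (S a), Finset.insert_subset hxa (hS a ha), ?_, fun s hs => ?_⟩
    · rw [Finset.card_insert_of_notMem hxS, hSk a ha]
    · rcases Finset.mem_insert.1 hs with rfl | hs
      · exact hnear _ hx
      · linarith [spDist_triangle hc hl c (q a) s, hq a ha, hSρ a ha s hs]
  have : Nonempty W := ⟨c⟩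
  choose! x hx hxX using hhit
  have hxsep : ∀ a ∈ I, ∀ b ∈ I, a ≠ b → L - 2 * ρ ≤ spDist H len (x a) (x b) := by
    intro a ha b hb hab
    have h1 := hSρ a ha _ (hmem a ha _ (hx a ha) (hxX a ha))
    have h2 := hSρ b hb _ (hmem b hb _ (hx b hb) (hxX b hb))
    rw [spDist_comm_s4 hc hl] at h2
    linarith [hsep a ha b hb hab, spDist_triangle hc hl (q a) (x a) (q b),
      spDist_triangle hc hl (x a) (x b) (q b)]
  have hinj : Set.InjOn x I := by
    intro a ha b hb hab
    by_contra hne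
    have := hxsep a ha b hb hne
    rw [hab, spDist_self hl] at this
    linarith
  obtain ⟨s, -, hs⟩ := exists_spDist_add_le_walkLength hc hl (L := L - 2 * ρ) p (I.image x)
    (hI.image x)
    (by
      intro y hy
      obtain ⟨a, ha, rfl⟩ := Finset.mem_image.1 hy
      exact hx a ha)
    (by
      intro y hy z hz hyz
      obtain ⟨a, ha, rfl⟩ := Finset.mem_image.1 hy
      obtain ⟨b, hb, rfl⟩ := Finset.mem_image.1 hz
      exact hxsep a ha b hb (by rintro rfl; exact hyz rfl))
  rw [Finset.card_image_of_injOn hinj] at hs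
  linarith [spDist_nonneg (G := H) hl u s]

/-- Every non-contracting map of `(G, len)` into a path-decomposed metric graph whose `w`-weighted
total distance is at most `A` has a bag with `k + 1` vertices at distance at most `ρ` from the
image of `r`. -/
def ForcesWideBag {V : Type*} [Fintype V] (G : SimpleGraph V) (len : Sym2 V → ℝ) (r : V)
    (w : V → V → ℝ) (k : ℕ) (A ρ : ℝ) : Prop :=
  ∀ (n : ℕ) (H : SimpleGraph (Fin n)) (lenH : Sym2 (Fin n) → ℝ), H.Connected →
    (∀ e, 0 ≤ lenH e) → ∀ (t : ℕ) (X : Fin t → Finset (Fin n)), IsPathDecomp H t X →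
    ∀ F : V → Fin n, (∀ x y, spDist G len x y ≤ spDist H lenH (F x) (F y)) →
      ∑ x, ∑ y, w x y * spDist H lenH (F x) (F y) ≤ A →
      ∃ i, ∃ S ⊆ X i, S.card = k + 1 ∧ ∀ s ∈ S, spDist H lenH (F r) s ≤ ρ

open Classical in
/-- Weights on the pairs of vertices of a broom, averaging over its copies. -/
noncomputable def broomWeight {V : Type*} (m : ℕ) (r : V) (w : V → V → ℝ) (L : ℝ) :
    Option (Fin m × V) → Option (Fin m × V) → ℝ
  | none, some q => if q.2 = r then 1 / (m * L) else 0
  | some p, some q => if p.1 = q.1 then w p.2 q.2 / m else 0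
  | _, none => 0

theorem broomWeight_nonneg {V : Type*} {m : ℕ} {r : V} {w : V → V → ℝ} {L : ℝ}
    (hw : ∀ x y, 0 ≤ w x y) (hL : 0 ≤ L) (x y) : 0 ≤ broomWeight m r w L x y := by
  rcases x with _ | p <;> rcases y with _ | q <;> simp only [broomWeight]
  · exact le_rfl
  · split_ifs <;> positivity
  · exact le_rfl
  · split_ifs
    · exact div_nonneg (hw _ _) (Nat.cast_nonneg _)
    · exact le_rfl

theorem sum_broomWeight_mul {V : Type*} [Fintype V] {m : ℕ} {r : V} {w : V → V → ℝ} {L : ℝ}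
    (f : Option (Fin m × V) → Option (Fin m × V) → ℝ) :
    ∑ x, ∑ y, broomWeight m r w L x y * f x y =
      (∑ a, (f none (some (a, r)) / L +
        ∑ x, ∑ y, w x y * f (some (a, x)) (some (a, y)))) / m := by
  classical
  simp only [Fintype.sum_option, broomWeight, Fintype.sum_prod_type, zero_mul, zero_add, ite_mul,
    Finset.sum_ite_eq', Finset.mem_univ, if_true]
  rw [Finset.sum_add_distrib, add_div, Finset.sum_div, Finset.sum_div]
  congr 1
  · refine Finset.sum_congr rfl fun a _ => ?_
    simp only [div_eq_mul_inv, mul_inv]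
    ring
  · refine Finset.sum_congr rfl fun a _ => ?_
    rw [Finset.sum_div]
    refine Finset.sum_congr rfl fun x _ => ?_
    rw [Finset.sum_comm, Finset.sum_div]
    refine Finset.sum_congr rfl fun y _ => ?_
    simp only [Finset.sum_ite_eq, Finset.mem_univ, if_true]
    ring

/-- Markov's inequality for the uniform average. -/
theorem le_two_mul_card_filter_le {m : ℕ} (f : Fin m → ℝ) {A : ℝ} (hA : 0 < A)
    (hf : ∀ a, 0 ≤ f a) (h : ∑ a, f a ≤ A * m) :
    (m : ℝ) ≤ 2 * ((Finset.univ.filter fun a => f a ≤ 2 * A).card : ℝ) := by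
  have hsplit := Finset.card_filter_add_card_filter_not (s := (Finset.univ : Finset (Fin m)))
    (fun a => f a ≤ 2 * A)
  have hbad : ((Finset.univ.filter fun a => ¬ f a ≤ 2 * A).card : ℝ) * (2 * A) ≤ A * m := by
    refine le_trans ?_ h
    rw [← nsmul_eq_mul]
    refine (Finset.card_nsmul_le_sum _ f _ fun a ha => ?_).trans
      (Finset.sum_le_univ_sum_of_nonneg hf)
    exact (not_le.1 (Finset.mem_filter.1 ha).2).le
  rw [Finset.card_univ, Fintype.card_fin] at hsplit
  have hsplit' : ((Finset.univ.filter fun a => f a ≤ 2 * A).card : ℝ) +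
      ((Finset.univ.filter fun a => ¬ f a ≤ 2 * A).card : ℝ) = m := by exact_mod_cast hsplit
  have : ((Finset.univ.filter fun a => ¬ f a ≤ 2 * A).card : ℝ) * 2 ≤ m := by
    refine le_of_mul_le_mul_right ?_ hA
    linarith
  linarith

theorem ForcesWideBag.broom {V : Type} [Fintype V] {G : SimpleGraph V} {len : Sym2 V → ℝ} {r : V}
    {w : V → V → ℝ} {k : ℕ} {A ρ L : ℝ} {m : ℕ} (hG : G.Connected) (hl : ∀ e, 0 ≤ len e)
    (hw : ∀ x y, 0 ≤ w x y) (hA : 0 < A) (hρ : 0 ≤ ρ) (hL : L = 4 * ρ + 4)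
    (hm : 16 * A + 10 ≤ m) (h : ForcesWideBag G len r w k (2 * A) ρ) :
    ForcesWideBag (broom m G r) (broomLen m r len L) none (broomWeight m r w L) (k + 1) A
      (3 * (2 * A * L) + 3 * ρ + 1) := by
  intro n H lenH hH hlH t X hX F hF hsum
  have hL0 : 0 < L := by linarith
  have hm0 : (0 : ℝ) < m := by linarith
  rw [sum_broomWeight_mul (fun x y => spDist H lenH (F x) (F y)), div_le_iff₀ hm0] at hsum
  have h1 : ∀ a, 0 ≤ spDist H lenH (F none) (F (some (a, r))) / L := fun a =>
    div_nonneg (spDist_nonneg hlH _ _) hL0.le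
  have h2 : ∀ a, 0 ≤ ∑ x, ∑ y, w x y * spDist H lenH (F (some (a, x))) (F (some (a, y))) :=
    fun a => Finset.sum_nonneg fun x _ => Finset.sum_nonneg fun y _ =>
      mul_nonneg (hw x y) (spDist_nonneg hlH _ _)
  have hcard := le_two_mul_card_filter_le _ hA (fun a => add_nonneg (h1 a) (h2 a)) hsum
  set I := Finset.univ.filter fun a : Fin m =>
    spDist H lenH (F none) (F (some (a, r))) / L +
      ∑ x, ∑ y, w x y * spDist H lenH (F (some (a, x))) (F (some (a, y))) ≤ 2 * A with hIdef
  have hIcard : 8 * A + 4 ≤ (I.card : ℝ) - 1 := by linarith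
  have hmemI : ∀ a ∈ I, spDist H lenH (F none) (F (some (a, r))) / L +
      ∑ x, ∑ y, w x y * spDist H lenH (F (some (a, x))) (F (some (a, y))) ≤ 2 * A :=
    fun a ha => (Finset.mem_filter.1 ha).2
  have hbag : ∀ a ∈ I, ∃ i, ∃ S ⊆ X i, S.card = k + 1 ∧
      ∀ s ∈ S, spDist H lenH (F (some (a, r))) s ≤ ρ := fun a ha =>
    h n H lenH hH hlH t X hX (fun x => F (some (a, x)))
      (fun x y => (spDist_le_spDist_broom_copy hG hl hL0.le a x y).trans (hF _ _))
      (by linarith [hmemI a ha, h1 a])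
  have hne : I.Nonempty := by
    rw [← Finset.card_pos]
    have : (0 : ℝ) < I.card := by linarith
    exact_mod_cast this
  have : Nonempty (Fin t) := by
    obtain ⟨a, ha⟩ := hne
    exact ⟨(hbag a ha).choose⟩
  choose! bag S hS hSk hSρ using hbag
  refine hX.exists_larger_bag (L := L) hH hlH hρ (by positivity) (by linarith) I hne ?_ (F none)
    (fun a => F (some (a, r))) (fun a ha => ?_) (fun a _ b _ hab => ?_) bag S hS hSk hSρ
  · have hmul : (8 * A + 4) * (L - 2 * ρ) ≤ ((I.card : ℝ) - 1) * (L - 2 * ρ) :=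
      mul_le_mul_of_nonneg_right hIcard (by linarith)
    refine lt_of_lt_of_le ?_ hmul
    rw [hL]
    nlinarith [mul_nonneg hA.le hρ]
  · rw [← div_le_iff₀ hL0]
    linarith [hmemI a ha, h2 a]
  · exact (le_spDist_broom_of_ne hG hl hL0.le hab r r).trans (hF _ _)

theorem exists_tree_forcesWideBag (k : ℕ) (A : ℝ) (hA : 0 < A) :
    ∃ (V : Type) (_ : Fintype V) (G : SimpleGraph V) (len : Sym2 V → ℝ) (r : V)
      (w : V → V → ℝ) (ρ : ℝ), G.IsTree ∧ pathwidthLE G k ∧ (∀ e, 0 ≤ len e) ∧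
      (∀ x y, 0 ≤ w x y) ∧ 0 ≤ ρ ∧ ∑ x, ∑ y, w x y * spDist G len x y ≤ k ∧
      ForcesWideBag G len r w k A ρ := by
  induction k generalizing A with
  | zero =>
    refine ⟨Unit, inferInstance, ⊥, fun _ => 0, (), fun _ _ => 0, 0, .of_subsingleton,
      ⟨1, fun _ => {()}, ⟨fun _ => ⟨0, by simp⟩, fun u v h => ?_, fun v i j l _ _ _ _ => by simp⟩,
        by simp⟩, by simp, by simp, le_rfl, by simp, ?_⟩
    · exact ⟨0, by simp⟩
    · intro n H lenH hH hlH t X hX F _ _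
      obtain ⟨i, hi⟩ := hX.1 (F ())
      exact ⟨i, {F ()}, by simpa using hi, by simp, by simp [spDist_self hlH]⟩
  | succ k ih =>
    obtain ⟨V, _, G, len, r, w, ρ, hT, hpw, hl, hw, hρ, hsum, hF⟩ := ih (2 * A) (by linarith)
    obtain ⟨m, hm⟩ := exists_nat_ge (16 * A + 10)
    have hm0 : (0 : ℝ) < m := by linarith
    have hL : 0 < 4 * ρ + 4 := by linarith
    refine ⟨Option (Fin m × V), inferInstance, broom m G r, broomLen m r len (4 * ρ + 4), none,
      broomWeight m r w (4 * ρ + 4), _, broom_isTree hT, broom_pathwidthLE (by exact_mod_cast hm0) hpw,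
      broomLen_nonneg hl hL.le, broomWeight_nonneg hw hL.le, ?_, ?_,
      hF.broom hT.connected hl hw hA hρ rfl hm⟩
    · positivity
    · rw [sum_broomWeight_mul, div_le_iff₀ hm0]
      have : ∀ a : Fin m, spDist (broom m G r) (broomLen m r len (4 * ρ + 4)) none (some (a, r)) /
          (4 * ρ + 4) + ∑ x, ∑ y, w x y * spDist (broom m G r) (broomLen m r len (4 * ρ + 4))
            (some (a, x)) (some (a, y)) ≤ k + 1 := by
        intro a
        rw [add_comm]
        refine add_le_add (le_trans ?_ hsum) ?_
        · exact Finset.sum_le_sum fun x _ => Finset.sum_le_sum fun y _ =>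
            mul_le_mul_of_nonneg_left (spDist_broom_copy_le hT.connected hl hL.le a x y) (hw x y)
        · exact (div_le_one hL).2 (spDist_broom_root_le hl hL.le a)
      refine (Finset.sum_le_card_nsmul _ _ _ fun a _ => this a).trans (le_of_eq ?_)
      simp only [Finset.card_univ, Fintype.card_fin, nsmul_eq_mul]
      push_cast
      ring

theorem pathwidthLE.of_iso {V W : Type*} {G : SimpleGraph V} {H : SimpleGraph W} {k : ℕ}
    (h : pathwidthLE G k) (e : G ≃g H) : pathwidthLE H k := by
  obtain ⟨t, X, hX, hk⟩ := h
  have hmem : ∀ v i, v ∈ (X i).map e.toEquiv.toEmbedding ↔ e.symm v ∈ X i := fun v i =>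
    Finset.mem_map_equiv
  refine ⟨t, fun i => (X i).map e.toEquiv.toEmbedding, ⟨fun v => ?_, fun u v huv => ?_,
    fun v i j l => ?_⟩, fun i => by simpa using hk i⟩
  · simpa only [hmem] using hX.1 (e.symm v)
  · simpa only [hmem] using hX.2.1 (e.symm.map_adj_iff.2 huv)
  · simpa only [hmem] using hX.2.2 (e.symm v) i j l

theorem spDist_le_of_hom {V W : Type*} {G : SimpleGraph V} {H : SimpleGraph W}
    {len : Sym2 V → ℝ} {lenH : Sym2 W → ℝ} (hG : G.Connected) (hH : H.Connected)
    (hl : ∀ e, 0 ≤ lenH e) (f : G →g H) (h : ∀ x y, lenH s(f x, f y) ≤ len s(x, y)) (u v : V) :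
    spDist H lenH (f u) (f v) ≤ spDist G len u v :=
  le_spDist_of_adj hG (fun u v => spDist H lenH (f u) (f v)) (fun _ => (spDist_self hl _).le)
    (fun _ _ _ => spDist_triangle hH hl _ _ _)
    (fun x y hxy => (spDist_le_of_adj hl (f.map_adj hxy)).trans (h x y)) u v

theorem exists_supportedMetric {V : Type} [Fintype V] {G : SimpleGraph V} {len : Sym2 V → ℝ}
    {k : ℕ} (hT : G.IsTree) (hpw : pathwidthLE G k) (hl : ∀ e, 0 ≤ len e) :
    ∃ Y ∈ SupportedMetrics (TreePathwidthFam k), ∃ e : V → Fin Y.1,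
      ∀ x y, Y.2 (e x) (e y) = spDist G len x y := by
  let e := Fintype.equivFin V
  let H : SimpleGraph (Fin (Fintype.card V)) := G.map e.toEmbedding
  let φ : G ≃g H := SimpleGraph.Iso.map e G
  have hH : H.IsTree := φ.isTree_iff.1 hT
  let lenH : Sym2 (Fin (Fintype.card V)) → ℝ := fun s => len (s.map φ.symm)
  refine ⟨⟨Fintype.card V, spDist H lenH⟩, ⟨H, ⟨hH, hpw.of_iso φ⟩, hH.connected, lenH,
    fun s => hl _, fun _ _ => rfl⟩, φ, fun x y => le_antisymm ?_ ?_⟩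
  · exact spDist_le_of_hom hT.connected hH.connected (fun s => hl _) φ.toHom
      (fun x y => by simp) x y
  · simpa using spDist_le_of_hom hH.connected hT.connected hl φ.symm.toHom
      (fun x y => le_of_eq (by simp [lenH])) (φ x) (φ y)

/-- **Theorem.** For every `k ≥ 1` there is no constant `D` such that every shortest-path
metric supported on a tree of pathwidth at most `k+1` admits a stochastic `D`-embedding into
the shortest-path metrics supported on graphs of pathwidth at most `k`:
`Pathwidth(k+1) ∩ Trees ⇝̸ Pathwidth(k)`. -/
theorem trees_of_pathwidth_not_into_pathwidth (k : ℕ) (hk : 1 ≤ k) :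
    ¬ ∃ D : ℝ, ∀ Y ∈ SupportedMetrics (TreePathwidthFam (k + 1)),
        StochEmbeds Y.2 (SupportedMetrics (PathwidthFam k)) D := by
  rintro ⟨D, hD⟩
  have hA : 0 < |D| * (k + 1) + 1 := by positivity
  obtain ⟨V, _, G, len, r, w, ρ, hT, hpw, hl, hw, -, hsum, hforce⟩ :=
    exists_tree_forcesWideBag (k + 1) _ hA
  obtain ⟨Y, hY, e, he⟩ := exists_supportedMetric hT hpw hl
  obtain ⟨N, p, Z, F, hp, hp1, hZ, hF, hE⟩ := hD Y hY
  let Φ : Fin N → ℝ := fun ω => ∑ x, ∑ y, w x y * (Z ω).2 (F ω (e x)) (F ω (e y))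
  have hΦ : ∑ ω, p ω * Φ ω ≤ |D| * (k + 1) := by
    calc ∑ ω, p ω * Φ ω
        = ∑ x, ∑ y, w x y * ∑ ω, p ω * (Z ω).2 (F ω (e x)) (F ω (e y)) := by
          simp only [Φ, Finset.mul_sum]
          rw [Finset.sum_comm]
          refine Finset.sum_congr rfl fun x _ => ?_
          rw [Finset.sum_comm]
          refine Finset.sum_congr rfl fun y _ => Finset.sum_congr rfl fun ω _ => ?_
          ring
      _ ≤ ∑ x, ∑ y, |D| * (w x y * spDist G len x y) := by
          refine Finset.sum_le_sum fun x _ => Finset.sum_le_sum fun y _ => ?_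
          have h1 := hE (e x) (e y)
          rw [he] at h1
          have h2 := mul_le_mul_of_nonneg_right (le_abs_self D) (spDist_nonneg (G := G) hl x y)
          calc _ ≤ w x y * (|D| * spDist G len x y) :=
                mul_le_mul_of_nonneg_left (h1.trans h2) (hw x y)
            _ = _ := by ring
      _ ≤ |D| * (k + 1) := by
          simp only [← Finset.mul_sum]
          exact mul_le_mul_of_nonneg_left (by exact_mod_cast hsum) (abs_nonneg D)
  obtain ⟨ω, hω, hΦω⟩ : ∃ ω, p ω ≠ 0 ∧ Φ ω ≤ |D| * (k + 1) + 1 := by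
    by_contra! hcon
    have : ∑ ω, p ω * (|D| * (k + 1) + 1) ≤ ∑ ω, p ω * Φ ω := by
      refine Finset.sum_le_sum fun ω _ => ?_
      by_cases h0 : p ω = 0
      · simp [h0]
      · exact mul_le_mul_of_nonneg_left (hcon ω h0).le (hp ω)
    rw [← Finset.sum_mul, hp1] at this
    linarith
  obtain ⟨H, ⟨t, X, hX, hXk⟩, hH, lenH, hlH, hdist⟩ := hZ ω hω
  obtain ⟨i, S, hS, hSk, -⟩ := hforce _ H lenH hH hlH t X hX (fun x => F ω (e x))
    (fun x y => by rw [← hdist, ← he]; exact hF ω hω _ _)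
    (by simpa only [← hdist] using hΦω)
  have := (Finset.card_le_card hS).trans (hXk i)
  omega
end
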